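/- arXiv:1910.04088 — 7 statements merged into one kernel-verified Lean document; each statement's English description precedes it below -/
import Mathlib

section
/- Let d, κ ≥ 1 be integers and C₀ > 0. Let c : ℝ^d → ℝ^{κ×κ} be measurable with |c_{lm}(x)| ≤ C₀(1+|x|)^{−d} for all x ∈ ℝ^d and all 1 ≤ l,m ≤ κ. Then there exists a constant C, depending only on d and κ, such that for every continuous compactly supported h : ℝ^d → ℝ^κ one has |∫_{ℝ^d}∫_{ℝ^d} h(x)·c(x−y)h(y) dx dy| ≤ C C₀ ∫_{ℝ^d} log(2+|x|) |h(x)|² dx. -/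
open MeasureTheory

theorem div_le_two_mul_rpow_mul_rpow_neg {X M m ε : ℝ} (hX : 0 < X) (hm : 0 < m) (hmM : m ≤ M)
    (hXM : X ≤ 2 * M) (hε : 0 < ε) (hε1 : ε ≤ 1) :
    X / M ≤ 2 * (X ^ ε * m ^ (-ε)) := by
  have hM : 0 < M := hm.trans_le hmM
  have h1 : X / (2 * M) ≤ (X / (2 * M)) ^ ε := by
    have := Real.rpow_le_rpow_of_exponent_ge (x := X / (2 * M)) (by positivity)
      ((div_le_one (by positivity)).2 hXM) hε1
    rwa [Real.rpow_one] at this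
  have h2 : (X / (2 * M)) ^ ε ≤ (X / m) ^ ε := by
    apply Real.rpow_le_rpow (by positivity) _ hε.le
    gcongr
    linarith
  rw [Real.rpow_neg hm.le, ← div_eq_mul_inv, ← Real.div_rpow hX.le hm.le]
  calc X / M = 2 * (X / (2 * M)) := by field_simp
    _ ≤ _ := by linarith

theorem rpow_neg_mul_div_le {X Y Z s ε : ℝ} (hX : 0 < X) (hY : 0 < Y) (hZ : 0 < Z)
    (hXYZ : X ≤ Y + Z) (hs : 1 ≤ s) (hε : 0 < ε) (hε1 : ε ≤ 1) :
    Z ^ (-s) * (X / Y) ≤ 2 * X ^ ε * (Z ^ (-(s + ε)) + Y ^ (-(s + ε))) := by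
  have hXε : 0 < X ^ ε := Real.rpow_pos_of_pos hX _
  have split (m : ℝ) (hm : 0 < m) : m ^ (-(s + ε)) = m ^ (-s) * m ^ (-ε) := by
    rw [neg_add, Real.rpow_add hm]
  have hZ' := Real.rpow_pos_of_pos hZ (-(s + ε))
  have hY' := Real.rpow_pos_of_pos hY (-(s + ε))
  rcases le_total Z Y with h | h
  · calc Z ^ (-s) * (X / Y) ≤ Z ^ (-s) * (2 * (X ^ ε * Z ^ (-ε))) := by
          gcongr
          exact div_le_two_mul_rpow_mul_rpow_neg hX hZ h (by linarith) hε hε1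
      _ = 2 * X ^ ε * Z ^ (-(s + ε)) := by rw [split Z hZ]; ring
      _ ≤ _ := by gcongr; linarith
  · calc Z ^ (-s) * (X / Y) = Z ^ (1 - s) * (X / Z) / Y := by
          rw [sub_eq_add_neg, Real.rpow_add hZ, Real.rpow_one]; field_simp
      _ ≤ Y ^ (1 - s) * (X / Z) / Y := by
          gcongr ?_ * _ / _
          exact Real.rpow_le_rpow_of_nonpos hY h (by linarith)
      _ = Y ^ (-s) * (X / Z) := by
          rw [sub_eq_add_neg, Real.rpow_add hY, Real.rpow_one]; field_simp
      _ ≤ Y ^ (-s) * (2 * (X ^ ε * Y ^ (-ε))) := by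
          gcongr
          exact div_le_two_mul_rpow_mul_rpow_neg hX hY h (by linarith) hε hε1
      _ = 2 * X ^ ε * Y ^ (-(s + ε)) := by rw [split Y hY]; ring
      _ ≤ _ := by gcongr; linarith

theorem integral_Ioi_add_one_rpow {ε : ℝ} (hε : 0 < ε) :
    ∫ y in Set.Ioi (0 : ℝ), (y + 1) ^ (-1 - ε) = 1 / ε := by
  have h := (measurePreserving_add_right volume (1 : ℝ)).setIntegral_preimage_emb
    (measurableEmbedding_addRight 1) (fun t : ℝ => t ^ (-1 - ε)) (Set.Ioi 1)
  rw [Set.preimage_add_const_Ioi, sub_self] at h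
  rw [h, integral_Ioi_rpow_of_lt (by linarith) one_pos, Real.one_rpow,
    show -1 - ε + 1 = -ε by ring, neg_div_neg_eq]

theorem integral_one_add_norm_rpow_le (d : ℕ) (hd : 1 ≤ d) {ε : ℝ} (hε : 0 < ε) :
    ∫ x : EuclideanSpace ℝ (Fin d), (1 + ‖x‖) ^ (-((d : ℝ) + ε)) ≤
      d * volume.real (Metric.ball (0 : EuclideanSpace ℝ (Fin d)) 1) * (1 / ε) := by
  have : Nonempty (Fin d) := ⟨⟨0, hd⟩⟩
  rw [integral_fun_norm_addHaar volume (fun t : ℝ => (1 + t) ^ (-((d : ℝ) + ε))),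
    finrank_euclideanSpace_fin, nsmul_eq_mul, smul_eq_mul, mul_assoc,
    ← integral_Ioi_add_one_rpow hε]
  refine mul_le_mul_of_nonneg_left (mul_le_mul_of_nonneg_left ?_ (by positivity)) (by positivity)
  apply integral_mono_of_nonneg
  · filter_upwards [ae_restrict_mem measurableSet_Ioi] with y hy
    have : (0 : ℝ) < y := hy
    simp only [smul_eq_mul, Pi.zero_apply]
    positivity
  · exact integrableOn_add_rpow_Ioi_of_lt (by linarith) (by norm_num)
  · filter_upwards [ae_restrict_mem measurableSet_Ioi] with y hy
    have hy : (0 : ℝ) < y := hy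
    have hdc : ((d - 1 : ℕ) : ℝ) = d - 1 := by push_cast [hd]; ring
    calc y ^ (d - 1) • (1 + y) ^ (-((d : ℝ) + ε))
        ≤ (y + 1) ^ (d - 1) * (y + 1) ^ (-((d : ℝ) + ε)) := by
          rw [smul_eq_mul, add_comm 1 y]
          gcongr
          linarith
      _ = (y + 1) ^ (-1 - ε) := by
          rw [← Real.rpow_natCast, ← Real.rpow_add (by linarith), hdc]
          congr 1; ring

/-- Schur-test bound for the kernel `(1 + ‖x - y‖) ^ (-d)` with the weight `1 + ‖·‖`. -/
theorem exists_lintegral_kernel_le (d : ℕ) (hd : 1 ≤ d) :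
    ∃ B : ℝ, 0 < B ∧ ∀ x : EuclideanSpace ℝ (Fin d),
      ∫⁻ y : EuclideanSpace ℝ (Fin d),
          ENNReal.ofReal ((1 + ‖x - y‖) ^ (-(d : ℝ)) * ((1 + ‖x‖) / (1 + ‖y‖))) ≤
        ENNReal.ofReal (B * Real.log (2 + ‖x‖)) := by
  set A := d * volume.real (Metric.ball (0 : EuclideanSpace ℝ (Fin d)) 1) with hA
  have hA0 : 0 ≤ A := by positivity
  refine ⟨12 * Real.exp 1 * A + 1, by positivity, fun x => ?_⟩
  set X := 1 + ‖x‖ with hX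
  have hX1 : 1 ≤ X := by simp [hX]
  have hX0 : 0 < X := by linarith
  have hlog : 0 ≤ Real.log X := Real.log_nonneg hX1
  set ε := 1 / (1 + Real.log X) with hεd
  have hε : 0 < ε := by positivity
  have hε1 : ε ≤ 1 := by rw [hεd, div_le_one (by positivity)]; linarith
  have hint : Integrable
      (fun z : EuclideanSpace ℝ (Fin d) => (1 + ‖z‖) ^ (-((d : ℝ) + ε))) volume :=
    integrable_one_add_norm (by simpa using hε)
  set J := ∫ z : EuclideanSpace ℝ (Fin d), (1 + ‖z‖) ^ (-((d : ℝ) + ε)) with hJ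
  have hJ0 : 0 ≤ J := integral_nonneg fun z => by positivity
  have hJle : J ≤ A * (1 / ε) := integral_one_add_norm_rpow_le d hd hε
  have hJl : ∫⁻ z : EuclideanSpace ℝ (Fin d), ENNReal.ofReal ((1 + ‖z‖) ^ (-((d : ℝ) + ε))) =
      ENNReal.ofReal J :=
    (ofReal_integral_eq_lintegral_ofReal hint (ae_of_all _ fun z => by positivity)).symm
  have hXε : X ^ ε ≤ Real.exp 1 := by
    rw [Real.rpow_def_of_pos hX0, hεd]
    apply Real.exp_le_exp.2
    rw [mul_one_div, div_le_one (by positivity)]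
    linarith
  have hlog2 : 1 + Real.log X ≤ 3 * Real.log (2 + ‖x‖) := by
    have h1 : Real.log X ≤ Real.log (2 + ‖x‖) := Real.log_le_log hX0 (by rw [hX]; linarith)
    have h2 : Real.log 2 ≤ Real.log (2 + ‖x‖) :=
      Real.log_le_log two_pos (by linarith [norm_nonneg x])
    linarith [Real.log_two_gt_d9]
  calc ∫⁻ y : EuclideanSpace ℝ (Fin d),
          ENNReal.ofReal ((1 + ‖x - y‖) ^ (-(d : ℝ)) * (X / (1 + ‖y‖)))
      ≤ ∫⁻ y : EuclideanSpace ℝ (Fin d), ENNReal.ofReal (2 * X ^ ε) *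
          (ENNReal.ofReal ((1 + ‖x - y‖) ^ (-((d : ℝ) + ε))) +
            ENNReal.ofReal ((1 + ‖y‖) ^ (-((d : ℝ) + ε)))) := by
        apply lintegral_mono
        intro y
        dsimp only
        rw [← ENNReal.ofReal_add (by positivity) (by positivity),
          ← ENNReal.ofReal_mul (by positivity)]
        apply ENNReal.ofReal_le_ofReal
        refine rpow_neg_mul_div_le hX0 (by positivity) (by positivity) ?_ (by exact_mod_cast hd)
          hε hε1
        have := norm_add_le (x - y) y
        rw [sub_add_cancel] at this
        rw [hX]; linarith
    _ = ENNReal.ofReal (2 * X ^ ε) * (ENNReal.ofReal J + ENNReal.ofReal J) := by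
        rw [lintegral_const_mul _ (by fun_prop), lintegral_add_left (by fun_prop),
          lintegral_sub_left_eq_self
            (fun z : EuclideanSpace ℝ (Fin d) => ENNReal.ofReal ((1 + ‖z‖) ^ (-((d : ℝ) + ε)))) x,
          hJl]
    _ = ENNReal.ofReal (4 * X ^ ε * J) := by
        rw [← ENNReal.ofReal_add hJ0 hJ0, ← ENNReal.ofReal_mul (by positivity)]
        congr 1; ring
    _ ≤ ENNReal.ofReal ((12 * Real.exp 1 * A + 1) * Real.log (2 + ‖x‖)) := by
        apply ENNReal.ofReal_le_ofReal
        have hl : 0 ≤ Real.log (2 + ‖x‖) := by linarith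
        calc 4 * X ^ ε * J ≤ 4 * Real.exp 1 * (A * (3 * Real.log (2 + ‖x‖))) := by
              have : J ≤ A * (3 * Real.log (2 + ‖x‖)) := by
                refine hJle.trans ?_
                rw [hεd, one_div_one_div]
                gcongr
              gcongr
          _ ≤ _ := by linarith

theorem abs_sum_sum_mul_le {κ : ℕ} (a b : EuclideanSpace ℝ (Fin κ)) (M : Fin κ → Fin κ → ℝ)
    {K : ℝ} (hM : ∀ l m, |M l m| ≤ K) :
    |∑ l, ∑ m, a l * M l m * b m| ≤ κ ^ 2 * (K * (‖a‖ * ‖b‖)) := by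
  calc |∑ l, ∑ m, a l * M l m * b m| ≤ ∑ l : Fin κ, ∑ m : Fin κ, |a l * M l m * b m| :=
        (Finset.abs_sum_le_sum_abs _ _).trans
          (Finset.sum_le_sum fun l _ => Finset.abs_sum_le_sum_abs _ _)
    _ ≤ ∑ _l : Fin κ, ∑ _m : Fin κ, K * (‖a‖ * ‖b‖) := by
        gcongr with l _ m _
        have ha : |a l| ≤ ‖a‖ := PiLp.norm_apply_le a l
        have hb : |b m| ≤ ‖b‖ := PiLp.norm_apply_le b m
        have hK := (abs_nonneg _).trans (hM l m)
        rw [abs_mul, abs_mul]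
        calc |a l| * |M l m| * |b m| ≤ ‖a‖ * K * ‖b‖ := by
              gcongr
              exact hM l m
          _ = _ := by ring
    _ = _ := by simp; ring

theorem lintegral_lintegral_kernel_mul_norm_le {d κ : ℕ} {B : ℝ}
    (hB : ∀ x : EuclideanSpace ℝ (Fin d),
      ∫⁻ y : EuclideanSpace ℝ (Fin d),
          ENNReal.ofReal ((1 + ‖x - y‖) ^ (-(d : ℝ)) * ((1 + ‖x‖) / (1 + ‖y‖))) ≤
        ENNReal.ofReal (B * Real.log (2 + ‖x‖)))
    (h : EuclideanSpace ℝ (Fin d) → EuclideanSpace ℝ (Fin κ)) (hh : Continuous h) :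
    ∫⁻ x, ∫⁻ y, ENNReal.ofReal ((1 + ‖x - y‖) ^ (-(d : ℝ)) * (‖h x‖ * ‖h y‖)) ≤
      2 * ∫⁻ x, ENNReal.ofReal (B * (Real.log (2 + ‖x‖) * ‖h x‖ ^ 2)) := by
  set p : EuclideanSpace ℝ (Fin d) → EuclideanSpace ℝ (Fin d) → ENNReal := fun x y =>
    ENNReal.ofReal (‖h x‖ ^ 2) *
      ENNReal.ofReal ((1 + ‖x - y‖) ^ (-(d : ℝ)) * ((1 + ‖x‖) / (1 + ‖y‖))) with hp
  have hpm : Measurable (Function.uncurry p) := by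
    have := hh.measurable
    rw [hp]
    unfold Function.uncurry
    fun_prop
  have hpint : ∫⁻ x, ∫⁻ y, p x y ≤
      ∫⁻ x, ENNReal.ofReal (B * (Real.log (2 + ‖x‖) * ‖h x‖ ^ 2)) := by
    apply lintegral_mono
    intro x
    simp only [hp]
    rw [lintegral_const_mul _ (by fun_prop)]
    calc _ ≤ ENNReal.ofReal (‖h x‖ ^ 2) * ENNReal.ofReal (B * Real.log (2 + ‖x‖)) := by
          gcongr
          exact hB x
      _ = _ := by
          rw [← ENNReal.ofReal_mul (by positivity)]
          congr 1; ring
  calc _ ≤ ∫⁻ x, ∫⁻ y, (p x y + p y x) := by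
        refine lintegral_mono fun x => lintegral_mono fun y => ?_
        simp only [hp]
        rw [← ENNReal.ofReal_mul (by positivity), ← ENNReal.ofReal_mul (by positivity),
          ← ENNReal.ofReal_add (by positivity) (by positivity), norm_sub_rev y x]
        apply ENNReal.ofReal_le_ofReal
        have hX : 0 < 1 + ‖x‖ := by positivity
        have hY : 0 < 1 + ‖y‖ := by positivity
        have key : ‖h x‖ * ‖h y‖ ≤ ‖h x‖ ^ 2 * ((1 + ‖x‖) / (1 + ‖y‖)) +
            ‖h y‖ ^ 2 * ((1 + ‖y‖) / (1 + ‖x‖)) := by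
          set t := (1 + ‖x‖) / (1 + ‖y‖) with ht
          have ht0 : 0 < t := by positivity
          have hti : (1 + ‖y‖) / (1 + ‖x‖) = t⁻¹ := by rw [ht, inv_div]
          rw [hti]
          have h1 : 0 ≤ t⁻¹ * (‖h x‖ * t - ‖h y‖) ^ 2 := by positivity
          have h2 : t⁻¹ * (‖h x‖ * t - ‖h y‖) ^ 2 =
              ‖h x‖ ^ 2 * t + ‖h y‖ ^ 2 * t⁻¹ - 2 * (‖h x‖ * ‖h y‖) := by
            field_simp; ring
          have h3 : 0 ≤ ‖h x‖ * ‖h y‖ := by positivity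
          linarith
        calc _ ≤ (1 + ‖x - y‖) ^ (-(d : ℝ)) * (‖h x‖ ^ 2 * ((1 + ‖x‖) / (1 + ‖y‖)) +
            ‖h y‖ ^ 2 * ((1 + ‖y‖) / (1 + ‖x‖))) := by gcongr
          _ = _ := by ring
    _ = (∫⁻ x, ∫⁻ y, p x y) + ∫⁻ x, ∫⁻ y, p y x := by
        rw [← lintegral_add_left hpm.lintegral_prod_right]
        refine lintegral_congr fun x => ?_
        exact lintegral_add_left (hpm.comp measurable_prodMk_left) _
    _ = 2 * ∫⁻ x, ∫⁻ y, p x y := by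
        rw [lintegral_lintegral_swap (f := fun x y => p y x)
          (hpm.comp measurable_swap).aemeasurable, two_mul]
    _ ≤ _ := by gcongr

theorem stmt_1 (d κ : ℕ) (hd : 1 ≤ d) (hκ : 1 ≤ κ) (C₀ : ℝ) (hC₀ : 0 < C₀) :
    ∃ C : ℝ, 0 < C ∧
      ∀ c : EuclideanSpace ℝ (Fin d) → Fin κ → Fin κ → ℝ,
        Measurable c →
        (∀ x : EuclideanSpace ℝ (Fin d), ∀ l m : Fin κ,
          |c x l m| ≤ C₀ * (1 + ‖x‖) ^ (-(d : ℝ))) →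
        ∀ h : EuclideanSpace ℝ (Fin d) → EuclideanSpace ℝ (Fin κ),
          Continuous h → HasCompactSupport h →
          |∫ x, ∫ y, ∑ l, ∑ m, h x l * c (x - y) l m * h y m| ≤
            C * C₀ * ∫ x, Real.log (2 + ‖x‖) * ‖h x‖ ^ 2 := by
  obtain ⟨B, hB0, hB⟩ := exists_lintegral_kernel_le d hd
  have hκ0 : (0 : ℝ) < κ := by exact_mod_cast hκ
  refine ⟨κ ^ 2 * (2 * B), by positivity, fun c _ hcb h hh hcs => ?_⟩
  have hlog (x : EuclideanSpace ℝ (Fin d)) : 0 ≤ Real.log (2 + ‖x‖) :=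
    Real.log_nonneg (by linarith [norm_nonneg x])
  have hcont : Continuous fun x => B * (Real.log (2 + ‖x‖) * ‖h x‖ ^ 2) := by
    have : Continuous fun x : EuclideanSpace ℝ (Fin d) => Real.log (2 + ‖x‖) :=
      Continuous.log (by fun_prop) fun x => by positivity
    fun_prop
  have hint : Integrable fun x => B * (Real.log (2 + ‖x‖) * ‖h x‖ ^ 2) := by
    refine hcont.integrable_of_hasCompactSupport (hcs.mono fun x hx => ?_)
    rw [Function.mem_support] at hx ⊢
    contrapose! hx
    simp [hx]
  have hR : ∫⁻ x, ENNReal.ofReal (B * (Real.log (2 + ‖x‖) * ‖h x‖ ^ 2)) =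
      ENNReal.ofReal (∫ x, B * (Real.log (2 + ‖x‖) * ‖h x‖ ^ 2)) :=
    (ofReal_integral_eq_lintegral_ofReal hint (ae_of_all _ fun x => by
      have := hlog x
      positivity)).symm
  have hI0 : 0 ≤ ∫ x, Real.log (2 + ‖x‖) * ‖h x‖ ^ 2 :=
    integral_nonneg fun x => mul_nonneg (hlog x) (by positivity)
  rw [← Real.norm_eq_abs, ← ENNReal.ofReal_le_ofReal_iff (by positivity), ofReal_norm]
  calc ‖∫ x, ∫ y, ∑ l, ∑ m, h x l * c (x - y) l m * h y m‖ₑ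
      ≤ ∫⁻ x, ∫⁻ y, ‖∑ l, ∑ m, h x l * c (x - y) l m * h y m‖ₑ :=
        (enorm_integral_le_lintegral_enorm _).trans
          (lintegral_mono fun x => enorm_integral_le_lintegral_enorm _)
    _ ≤ ∫⁻ x, ∫⁻ y, ENNReal.ofReal (κ ^ 2 * C₀) *
          ENNReal.ofReal ((1 + ‖x - y‖) ^ (-(d : ℝ)) * (‖h x‖ * ‖h y‖)) := by
        refine lintegral_mono fun x => lintegral_mono fun y => ?_
        rw [← ENNReal.ofReal_mul (by positivity), ← ofReal_norm, Real.norm_eq_abs]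
        apply ENNReal.ofReal_le_ofReal
        refine (abs_sum_sum_mul_le _ _ _ fun l m => hcb (x - y) l m).trans_eq ?_
        ring
    _ = ENNReal.ofReal (κ ^ 2 * C₀) * ∫⁻ x, ∫⁻ y,
          ENNReal.ofReal ((1 + ‖x - y‖) ^ (-(d : ℝ)) * (‖h x‖ * ‖h y‖)) := by
        simp_rw [lintegral_const_mul' _ _ ENNReal.ofReal_ne_top]
    _ ≤ ENNReal.ofReal (κ ^ 2 * C₀) *
          (2 * ENNReal.ofReal (∫ x, B * (Real.log (2 + ‖x‖) * ‖h x‖ ^ 2))) := by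
        rw [← hR]
        gcongr
        exact lintegral_lintegral_kernel_mul_norm_le hB h hh
    _ = ENNReal.ofReal (κ ^ 2 * (2 * B) * C₀ * ∫ x, Real.log (2 + ‖x‖) * ‖h x‖ ^ 2) := by
        rw [integral_const_mul, two_mul, ← ENNReal.ofReal_add (by positivity) (by positivity),
          ← ENNReal.ofReal_mul (by positivity)]
        congr 1; ring
end

section
/- Let d ≥ 1. There exists a constant C depending only on d such that for every x ∈ ℝ^d, ∫_{ℝ^d} (1+|y|)^{−1} (1+|x−y|)^{−d} dy ≤ C log(2+|x|)/(1+|x|). -/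
open MeasureTheory

/-- Polar coordinates: a radial function is integrable, with controlled integral, as soon as its
profile weighted by `s ^ n` is dominated by an integrable function on the half-line. -/
lemma radial_integrable_and_integral_le (n : ℕ) {h g : ℝ → ℝ} (hm : Measurable h)
    (h0 : ∀ s, 0 ≤ h s) (hg : IntegrableOn g (Set.Ioi 0))
    (hle : ∀ s, 0 < s → s ^ n * h s ≤ g s) :
    Integrable (fun y : EuclideanSpace ℝ (Fin (n + 1)) => h ‖y‖) ∧
      ∫ y : EuclideanSpace ℝ (Fin (n + 1)), h ‖y‖ ≤
        ((n + 1 : ℕ) : ℝ) * (volume : Measure (EuclideanSpace ℝ (Fin (n + 1)))).real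
          (Metric.ball 0 1) * ∫ s in Set.Ioi 0, g s := by
  have hi : IntegrableOn (fun s : ℝ => s ^ n * h s) (Set.Ioi 0) := by
    refine Integrable.mono' hg (by fun_prop) ?_
    filter_upwards [self_mem_ae_restrict measurableSet_Ioi] with s hs
    have hs : 0 < s := hs
    rw [Real.norm_of_nonneg (mul_nonneg (by positivity) (h0 s))]
    exact hle s hs
  constructor
  · rw [integrable_fun_norm_addHaar volume]
    simpa using hi
  · rw [integral_fun_norm_addHaar volume]
    simp only [finrank_euclideanSpace_fin, Nat.add_sub_cancel, nsmul_eq_mul, smul_eq_mul]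
    rw [mul_assoc]
    exact mul_le_mul_of_nonneg_left (mul_le_mul_of_nonneg_left
      (setIntegral_mono_on hi hg measurableSet_Ioi hle) measureReal_nonneg) (Nat.cast_nonneg _)

lemma integrableOn_and_integral_indicator_Iic_inv_one_add {ρ : ℝ} (hρ : 0 ≤ ρ) :
    IntegrableOn ((Set.Iic ρ).indicator fun s : ℝ => (1 + s)⁻¹) (Set.Ioi 0) ∧
      ∫ s in Set.Ioi 0, (Set.Iic ρ).indicator (fun s : ℝ => (1 + s)⁻¹) s = Real.log (1 + ρ) := by
  constructor
  · rw [IntegrableOn, integrable_indicator_iff measurableSet_Iic, IntegrableOn,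
      Measure.restrict_restrict measurableSet_Iic, Set.inter_comm, Set.Ioi_inter_Iic]
    refine (intervalIntegrable_iff_integrableOn_Ioc_of_le hρ).1
      (ContinuousOn.intervalIntegrable ?_)
    rw [Set.uIcc_of_le hρ]
    refine ContinuousOn.inv₀ (by fun_prop) fun s hs => ?_
    linarith [hs.1]
  · rw [setIntegral_indicator measurableSet_Iic, Set.Ioi_inter_Iic,
      ← intervalIntegral.integral_of_le hρ,
      intervalIntegral.integral_comp_add_left (fun s : ℝ => s⁻¹) 1,
      integral_inv_of_pos (by norm_num) (by linarith)]
    simp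

lemma integrableOn_and_integral_indicator_Ioi_inv_sq {ρ : ℝ} (hρ : 0 < ρ) :
    IntegrableOn ((Set.Ioi ρ).indicator fun s : ℝ => s ^ (-2 : ℝ)) (Set.Ioi 0) ∧
      ∫ s in Set.Ioi 0, (Set.Ioi ρ).indicator (fun s : ℝ => s ^ (-2 : ℝ)) s = ρ⁻¹ := by
  have hs : Set.Ioi (0 : ℝ) ∩ Set.Ioi ρ = Set.Ioi ρ := by
    rw [Set.Ioi_inter_Ioi, sup_of_le_right hρ.le]
  constructor
  · rw [IntegrableOn, integrable_indicator_iff measurableSet_Ioi, IntegrableOn,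
      Measure.restrict_restrict measurableSet_Ioi, Set.inter_comm, hs]
    exact integrableOn_Ioi_rpow_of_lt (by norm_num) hρ
  · rw [setIntegral_indicator measurableSet_Ioi, hs, integral_Ioi_rpow_of_lt (by norm_num) hρ]
    norm_num
    exact Real.rpow_neg_one ρ

/-- Splitting of the convolution integrand into the regions near `x`, near the origin and far
away, where `t = ‖x‖`, `a = ‖y‖` and `b = ‖x - y‖`. -/
lemma inv_mul_inv_pow_le_indicator_sum (m : ℕ) {t a b : ℝ} (ht : 0 ≤ t) (ha : 0 ≤ a)
    (hb : 0 ≤ b) (h1 : t ≤ a + b) (h2 : a ≤ t + b) :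
    (1 + a)⁻¹ * ((1 + b) ^ m)⁻¹ ≤
      2 / (1 + t) * (Set.Iic (1 + t)).indicator (fun s => ((1 + s) ^ m)⁻¹) b +
      2 ^ m * ((1 + t) ^ m)⁻¹ * (Set.Iic (2 * (1 + t))).indicator (fun s => (1 + s)⁻¹) a +
      2 ^ m * (Set.Ioi (2 * (1 + t))).indicator (fun s => ((1 + s) ^ (m + 1))⁻¹) a := by
  have p1 : 0 ≤ 2 / (1 + t) * (Set.Iic (1 + t)).indicator (fun s => ((1 + s) ^ m)⁻¹) b :=
    mul_nonneg (by positivity) (Set.indicator_apply_nonneg fun _ => by positivity)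
  have p2 : 0 ≤ 2 ^ m * ((1 + t) ^ m)⁻¹ *
      (Set.Iic (2 * (1 + t))).indicator (fun s => (1 + s)⁻¹) a :=
    mul_nonneg (by positivity) (Set.indicator_apply_nonneg fun _ => by positivity)
  have p3 : 0 ≤ 2 ^ m *
      (Set.Ioi (2 * (1 + t))).indicator (fun s => ((1 + s) ^ (m + 1))⁻¹) a :=
    mul_nonneg (by positivity) (Set.indicator_apply_nonneg fun _ => by positivity)
  have key : ∀ u : ℝ, 0 < u → u ≤ 2 * (1 + b) → ((1 + b) ^ m)⁻¹ ≤ 2 ^ m * (u ^ m)⁻¹ := by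
    intro u hu hub
    rw [← div_eq_mul_inv, ← div_pow, ← inv_pow]
    gcongr
    rw [inv_eq_one_div, div_le_div_iff₀ (by positivity) hu]
    linarith
  rcases le_or_gt b (t / 2) with hbt | hbt
  · have : (1 + a)⁻¹ * ((1 + b) ^ m)⁻¹ ≤
        2 / (1 + t) * (Set.Iic (1 + t)).indicator (fun s => ((1 + s) ^ m)⁻¹) b := by
      rw [Set.indicator_of_mem (by simp only [Set.mem_Iic]; linarith)]
      gcongr
      rw [inv_eq_one_div, div_le_div_iff₀ (by positivity) (by positivity)]
      linarith
    linarith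
  rcases le_or_gt a (2 * (1 + t)) with hat | hat
  · have : (1 + a)⁻¹ * ((1 + b) ^ m)⁻¹ ≤ 2 ^ m * ((1 + t) ^ m)⁻¹ *
        (Set.Iic (2 * (1 + t))).indicator (fun s => (1 + s)⁻¹) a := by
      rw [Set.indicator_of_mem (by simpa using hat), mul_comm]
      gcongr
      exact key _ (by positivity) (by linarith)
    linarith
  · have : (1 + a)⁻¹ * ((1 + b) ^ m)⁻¹ ≤ 2 ^ m *
        (Set.Ioi (2 * (1 + t))).indicator (fun s => ((1 + s) ^ (m + 1))⁻¹) a := by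
      rw [Set.indicator_of_mem (by simpa using hat), pow_succ, mul_inv, ← mul_assoc, mul_comm]
      gcongr
      exact key _ (by positivity) (by linarith)
    linarith

theorem stmt_3 (d : ℕ) (hd : 1 ≤ d) :
    ∃ C : ℝ, 0 < C ∧ ∀ x : EuclideanSpace ℝ (Fin d),
      ∫ y : EuclideanSpace ℝ (Fin d),
          (1 + ‖y‖)⁻¹ * (1 + ‖x - y‖) ^ (-(d : ℝ)) ≤
        C * Real.log (2 + ‖x‖) / (1 + ‖x‖) := by
  obtain ⟨n, rfl⟩ : ∃ n, d = n + 1 := ⟨d - 1, by omega⟩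
  set K : ℝ := ((n + 1 : ℕ) : ℝ) *
    (volume : Measure (EuclideanSpace ℝ (Fin (n + 1)))).real (Metric.ball 0 1) with hK
  have hK0 : 0 < K := mul_pos (by positivity)
    (ENNReal.toReal_pos (Metric.measure_ball_pos volume _ one_pos).ne' measure_ball_lt_top.ne)
  refine ⟨K * (2 + 4 ^ (n + 1) + 2 ^ (n + 1)), by positivity, fun x => ?_⟩
  have ht : 0 ≤ ‖x‖ := norm_nonneg x
  set t := ‖x‖
  obtain ⟨i1, e1⟩ := radial_integrable_and_integral_le n
    (h := (Set.Iic (1 + t)).indicator fun s => ((1 + |s|) ^ (n + 1))⁻¹)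
    (g := (Set.Iic (1 + t)).indicator fun s => (1 + s)⁻¹)
    (Measurable.indicator (by fun_prop) measurableSet_Iic)
    (fun s => Set.indicator_apply_nonneg fun _ => by positivity)
    (integrableOn_and_integral_indicator_Iic_inv_one_add (by positivity)).1 (by
      intro s hs
      by_cases h : s ∈ Set.Iic (1 + t)
      · rw [Set.indicator_of_mem h, Set.indicator_of_mem h, abs_of_pos hs, pow_succ, mul_inv,
          ← mul_assoc]
        refine mul_le_of_le_one_left (by positivity) ?_
        rw [← div_eq_mul_inv, div_le_one (by positivity)]
        gcongr
        linarith
      · simp [Set.indicator_of_notMem h])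
  rw [(integrableOn_and_integral_indicator_Iic_inv_one_add (by positivity)).2, ← hK] at e1
  obtain ⟨i2, e2⟩ := radial_integrable_and_integral_le n
    (h := (Set.Iic (2 * (1 + t))).indicator fun s => (1 + |s|)⁻¹)
    (g := fun s => (2 * (1 + t)) ^ n *
      (Set.Iic (2 * (1 + t))).indicator (fun s => (1 + s)⁻¹) s)
    (Measurable.indicator (by fun_prop) measurableSet_Iic)
    (fun s => Set.indicator_apply_nonneg fun _ => by positivity)
    ((integrableOn_and_integral_indicator_Iic_inv_one_add (by positivity)).1.const_mul _) (by
      intro s hs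
      by_cases h : s ∈ Set.Iic (2 * (1 + t))
      · rw [Set.indicator_of_mem h, Set.indicator_of_mem h, abs_of_pos hs]
        gcongr
        exact h
      · simp [Set.indicator_of_notMem h])
  rw [integral_const_mul,
    (integrableOn_and_integral_indicator_Iic_inv_one_add (by positivity)).2, ← hK] at e2
  obtain ⟨i3, e3⟩ := radial_integrable_and_integral_le n
    (h := (Set.Ioi (2 * (1 + t))).indicator fun s => ((1 + |s|) ^ (n + 1 + 1))⁻¹)
    (g := (Set.Ioi (2 * (1 + t))).indicator fun s => s ^ (-2 : ℝ))
    (Measurable.indicator (by fun_prop) measurableSet_Ioi)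
    (fun s => Set.indicator_apply_nonneg fun _ => by positivity)
    (integrableOn_and_integral_indicator_Ioi_inv_sq (by positivity)).1 (by
      intro s hs
      by_cases h : s ∈ Set.Ioi (2 * (1 + t))
      · rw [Set.indicator_of_mem h, Set.indicator_of_mem h, abs_of_pos hs, Real.rpow_neg hs.le,
          Real.rpow_ofNat, ← div_eq_mul_inv, inv_eq_one_div,
          div_le_div_iff₀ (by positivity) (by positivity), one_mul, ← pow_add]
        gcongr
        linarith
      · simp [Set.indicator_of_notMem h])
  rw [(integrableOn_and_integral_indicator_Ioi_inv_sq (by positivity)).2, ← hK] at e3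
  have hL : 1 / 2 ≤ Real.log (2 + t) := by
    have := Real.log_two_gt_d9
    have := Real.log_le_log (by norm_num : (0 : ℝ) < 2) (by linarith : 2 ≤ 2 + t)
    linarith
  have hL2 : Real.log (1 + 2 * (1 + t)) ≤ 2 * Real.log (2 + t) := by
    rw [← Real.log_rpow (by positivity), Real.rpow_ofNat]
    exact Real.log_le_log (by positivity) (by nlinarith)
  rw [show 1 + (1 + t) = 2 + t by ring] at e1
  have j1 := (i1.comp_sub_left x).const_mul (2 / (1 + t))
  have j2 := i2.const_mul (2 ^ (n + 1) * ((1 + t) ^ (n + 1))⁻¹)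
  have j3 := i3.const_mul (2 ^ (n + 1))
  rw [← integral_sub_left_eq_self _ volume x] at e1
  set L := Real.log (2 + t)
  calc _ ≤ _ := integral_mono_of_nonneg (Filter.Eventually.of_forall fun y => by positivity)
        ((j1.add j2).add j3) (Filter.Eventually.of_forall fun y => by
          have := inv_mul_inv_pow_le_indicator_sum (n + 1) ht (norm_nonneg y)
            (norm_nonneg (x - y)) (by simpa using norm_add_le y (x - y))
            (by simpa using norm_sub_le x (x - y))
          simp only [Pi.add_apply]
          rw [Real.rpow_neg (by positivity), Real.rpow_natCast]
          refine this.trans (le_of_eq ?_)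
          simp only [Set.indicator, abs_norm])
    _ = _ := by
      rw [integral_add' (j1.add j2) j3, integral_add' j1 j2, integral_const_mul,
        integral_const_mul, integral_const_mul]
    _ ≤ 2 / (1 + t) * (K * L) + 2 ^ (n + 1) * ((1 + t) ^ (n + 1))⁻¹ *
          (K * ((2 * (1 + t)) ^ n * (2 * L))) + 2 ^ (n + 1) * (K * (2 * (1 + t))⁻¹) := by
      gcongr
      exact e2.trans (by gcongr)
    _ ≤ 2 / (1 + t) * (K * L) + 2 ^ (n + 1) * ((1 + t) ^ (n + 1))⁻¹ *
          (K * ((2 * (1 + t)) ^ n * (2 * L))) + 2 ^ (n + 1) * (K * (L * (1 + t)⁻¹)) := by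
      gcongr
      rw [mul_inv]
      gcongr
      linarith
    _ = _ := by
      rw [show (4 : ℝ) = 2 * 2 by norm_num, mul_pow, mul_pow]
      field_simp
      ring
end

section
/- Let d ≥ 1. There exists a constant C depending only on d such that for every x ∈ ℝ^d, ∫_{ℝ^d} (1+|x−y|)^{−d} log(2+|x−y|)^{−1/2} · (1+|y|)^{−d} log(2+|y|)^{−1/2} dy ≤ C (1+|x|)^{−d}. -/
open MeasureTheory

/-- The radial profile `(1 + r) ^ (-d) * log (2 + r) ^ (-1/2)`. -/
noncomputable def criticalProfile (d : ℕ) (r : ℝ) : ℝ :=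
  (1 + r) ^ (-(d : ℝ)) * Real.log (2 + r) ^ (-(1 / 2) : ℝ)

lemma log_two_add_pos {r : ℝ} (hr : 0 ≤ r) : 0 < Real.log (2 + r) :=
  Real.log_pos (by linarith)

lemma criticalProfile_nonneg (d : ℕ) {r : ℝ} (hr : 0 ≤ r) : 0 ≤ criticalProfile d r :=
  mul_nonneg (Real.rpow_nonneg (by linarith) _) (Real.rpow_nonneg (log_two_add_pos hr).le _)

lemma criticalProfile_le_of_le (d : ℕ) {r s : ℝ} (hr : 0 ≤ r) (hrs : r ≤ s) :
    criticalProfile d s ≤ criticalProfile d r := by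
  have h1 := log_two_add_pos hr
  have h2 := log_two_add_pos (hr.trans hrs)
  unfold criticalProfile
  refine mul_le_mul ?_ ?_ (Real.rpow_nonneg h2.le _) (Real.rpow_nonneg (by linarith) _)
  · exact Real.rpow_le_rpow_of_nonpos (by linarith) (by linarith) (by simp)
  · exact Real.rpow_le_rpow_of_nonpos h1 (Real.log_le_log (by linarith) (by linarith))
      (by norm_num)

lemma criticalProfile_mul_self_le (d : ℕ) {r : ℝ} (hr : 0 ≤ r) :
    criticalProfile d r * criticalProfile d r ≤ 2 * (1 + r) ^ (-(2 * d : ℝ)) := by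
  have h1 := log_two_add_pos hr
  have e : criticalProfile d r * criticalProfile d r
      = (1 + r) ^ (-(2 * d : ℝ)) * (Real.log (2 + r))⁻¹ := by
    unfold criticalProfile
    rw [mul_mul_mul_comm, ← Real.rpow_add (by linarith), ← Real.rpow_add h1,
      ← Real.rpow_neg_one]
    ring_nf
  rw [e, mul_comm]
  refine mul_le_mul_of_nonneg_right ?_ (Real.rpow_nonneg (by linarith) _)
  rw [inv_le_comm₀ h1 two_pos]
  have := Real.log_le_log two_pos (by linarith : (2 : ℝ) ≤ 2 + r)
  have := Real.log_two_gt_d9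
  norm_num at *
  linarith

/-- A radial majorant of the part of the convolution integrand at `x` with `‖x‖ = R` where the
integration variable, of norm `r`, is closer to `0` than to `x`. -/
noncomputable def nearMajorant (d : ℕ) (R r : ℝ) : ℝ :=
  if r ≤ R then criticalProfile d (R / 2) * criticalProfile d r
  else 2 * (1 + r) ^ (-(2 * d : ℝ))

lemma nearMajorant_nonneg (d : ℕ) {R r : ℝ} (hR : 0 ≤ R) (hr : 0 ≤ r) :
    0 ≤ nearMajorant d R r := by
  unfold nearMajorant
  split_ifs
  · exact mul_nonneg (criticalProfile_nonneg d (by linarith)) (criticalProfile_nonneg d hr)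
  · have := Real.rpow_nonneg (by linarith : 0 ≤ 1 + r) (-(2 * d : ℝ))
    linarith

lemma measurable_nearMajorant (d : ℕ) (R : ℝ) : Measurable (nearMajorant d R) := by
  unfold nearMajorant criticalProfile
  refine Measurable.ite measurableSet_Iic ?_ ?_ <;> fun_prop

lemma criticalProfile_mul_le_nearMajorant (d : ℕ) {R r s : ℝ} (hR : 0 ≤ R) (hr : 0 ≤ r)
    (hrs : r ≤ s) (hRs : R ≤ r + s) :
    criticalProfile d s * criticalProfile d r ≤ nearMajorant d R r := by
  have h0 := criticalProfile_nonneg d hr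
  unfold nearMajorant
  split_ifs
  · exact mul_le_mul_of_nonneg_right
      (criticalProfile_le_of_le d (by linarith) (by linarith)) h0
  · exact (mul_le_mul_of_nonneg_right (criticalProfile_le_of_le d hr hrs) h0).trans
      (criticalProfile_mul_self_le d hr)

lemma pow_pred_mul_rpow_neg_le {d : ℕ} (hd : 1 ≤ d) {r : ℝ} (hr : 0 ≤ r) (a : ℝ) :
    r ^ (d - 1) * (1 + r) ^ (-a) ≤ (1 + r) ^ ((d : ℝ) - 1 - a) := by
  have h : 0 < 1 + r := by linarith
  calc r ^ (d - 1) * (1 + r) ^ (-a) ≤ (1 + r) ^ (d - 1) * (1 + r) ^ (-a) := by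
        gcongr; linarith
    _ = (1 + r) ^ ((d : ℝ) - 1 - a) := by
        rw [← Real.rpow_natCast, ← Real.rpow_add h, Nat.cast_sub hd]
        ring_nf

lemma integrableOn_integral_inv_mul_log_rpow {R : ℝ} (hR : 0 ≤ R) :
    IntegrableOn (fun r : ℝ ↦ 2 * ((2 + r)⁻¹ * Real.log (2 + r) ^ (-(1 / 2) : ℝ))) (Set.Ioc 0 R) ∧
    ∫ r in Set.Ioc 0 R, 2 * ((2 + r)⁻¹ * Real.log (2 + r) ^ (-(1 / 2) : ℝ)) ≤
      4 * Real.log (2 + R) ^ (1 / 2 : ℝ) := by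
  have hc : ContinuousOn (fun r : ℝ ↦ 2 * ((2 + r)⁻¹ * Real.log (2 + r) ^ (-(1 / 2) : ℝ)))
      (Set.uIcc 0 R) := by
    rw [Set.uIcc_of_le hR]
    intro r hr
    have h1 := log_two_add_pos hr.1
    have h2 : 2 + r ≠ 0 := by linarith [hr.1]
    refine ContinuousAt.continuousWithinAt ?_
    have : ContinuousAt (fun r : ℝ ↦ Real.log (2 + r)) r := by fun_prop (disch := assumption)
    exact continuousAt_const.mul (((by fun_prop : ContinuousAt (fun r : ℝ ↦ 2 + r) r).inv₀ h2).mul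
      (this.rpow_const (Or.inl h1.ne')))
  have hi := hc.intervalIntegrable (μ := volume)
  refine ⟨(intervalIntegrable_iff_integrableOn_Ioc_of_le hR).1 hi, ?_⟩
  rw [← intervalIntegral.integral_of_le hR,
    intervalIntegral.integral_eq_sub_of_hasDerivAt
      (f := fun r ↦ 4 * Real.log (2 + r) ^ (1 / 2 : ℝ)) ?_ hi]
  · have := Real.rpow_nonneg (log_two_add_pos le_rfl).le (1 / 2 : ℝ)
    linarith
  · intro r hr
    rw [Set.uIcc_of_le hR] at hr
    have h1 := log_two_add_pos hr.1
    have h2 : 2 + r ≠ 0 := by linarith [hr.1]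
    have := ((((hasDerivAt_id r).const_add 2).log h2).rpow_const
      (p := (1 / 2 : ℝ)) (Or.inl h1.ne')).const_mul 4
    refine this.congr_deriv ?_
    simp only [id]
    rw [show (1 / 2 : ℝ) - 1 = -(1 / 2) by norm_num]
    ring

lemma integrableOn_integral_one_add_rpow {d : ℕ} (hd : 1 ≤ d) {R : ℝ} (hR : 0 ≤ R) :
    IntegrableOn (fun r : ℝ ↦ 2 * (1 + r) ^ (-(d : ℝ) - 1)) (Set.Ioi R) ∧
    ∫ r in Set.Ioi R, 2 * (1 + r) ^ (-(d : ℝ) - 1) ≤ 2 * (1 + R) ^ (-(d : ℝ)) := by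
  have hd' : (1 : ℝ) ≤ d := by exact_mod_cast hd
  have hderiv : ∀ r ∈ Set.Ici R, HasDerivAt (fun r : ℝ ↦ -(2 / d) * (1 + r) ^ (-(d : ℝ)))
      (2 * (1 + r) ^ (-(d : ℝ) - 1)) r := by
    intro r hr
    have h1 : 1 + r ≠ 0 := by have := Set.mem_Ici.1 hr; linarith
    have := (((hasDerivAt_id r).const_add 1).rpow_const
      (p := -(d : ℝ)) (Or.inl h1)).const_mul (-(2 / d : ℝ))
    refine this.congr_deriv ?_
    simp only [id]
    field_simp
  have hnn : ∀ r ∈ Set.Ioi R, 0 ≤ 2 * (1 + r) ^ (-(d : ℝ) - 1) := by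
    intro r hr
    have : 0 ≤ 1 + r := by have := Set.mem_Ioi.1 hr; linarith
    positivity
  have ht : Filter.Tendsto (fun r : ℝ ↦ -(2 / d) * (1 + r) ^ (-(d : ℝ))) Filter.atTop
      (nhds (-(2 / d) * 0)) :=
    ((tendsto_rpow_neg_atTop (by linarith)).comp
      (Filter.tendsto_atTop_add_const_left _ 1 Filter.tendsto_id)).const_mul _
  refine ⟨integrableOn_Ioi_deriv_of_nonneg' hderiv hnn ht, ?_⟩
  rw [integral_Ioi_of_hasDerivAt_of_nonneg' hderiv hnn ht]
  have hp : 0 ≤ (1 + R) ^ (-(d : ℝ)) := Real.rpow_nonneg (by linarith) _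
  have h2 : (2 / d : ℝ) ≤ 2 := div_le_self (by norm_num) hd'
  nlinarith

lemma criticalProfile_half_mul_log_rpow_le (d : ℕ) {R : ℝ} (hR : 0 ≤ R) :
    criticalProfile d (R / 2) * Real.log (2 + R) ^ (1 / 2 : ℝ) ≤
      2 * 2 ^ d * (1 + R) ^ (-(d : ℝ)) := by
  have h1 : 0 < Real.log (2 + R / 2) := log_two_add_pos (by linarith)
  have h2 := log_two_add_pos hR
  have hlog : Real.log (2 + R) ≤ 4 * Real.log (2 + R / 2) := by
    have : Real.log (2 + R) ≤ Real.log ((2 + R / 2) ^ 2) :=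
      Real.log_le_log (by linarith) (by nlinarith)
    rw [Real.log_pow] at this
    push_cast at this
    linarith
  have hlog' : Real.log (2 + R / 2) ^ (-(1 / 2) : ℝ) * Real.log (2 + R) ^ (1 / 2 : ℝ) ≤ 2 := by
    calc _ ≤ Real.log (2 + R / 2) ^ (-(1 / 2) : ℝ) *
          (4 * Real.log (2 + R / 2)) ^ (1 / 2 : ℝ) := by gcongr
      _ = 4 ^ (1 / 2 : ℝ) := by
          rw [Real.mul_rpow (by norm_num) h1.le, mul_left_comm, ← Real.rpow_add h1]
          simp
      _ = 2 := by
          rw [← Real.sqrt_eq_rpow, show (4 : ℝ) = 2 ^ 2 by norm_num]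
          simp
  have hpow : (1 + R / 2) ^ (-(d : ℝ)) ≤ 2 ^ d * (1 + R) ^ (-(d : ℝ)) := by
    calc (1 + R / 2) ^ (-(d : ℝ)) ≤ ((1 + R) / 2) ^ (-(d : ℝ)) :=
          Real.rpow_le_rpow_of_nonpos (by linarith) (by linarith) (by simp)
      _ = 2 ^ d * (1 + R) ^ (-(d : ℝ)) := by
          rw [Real.div_rpow (by linarith) (by norm_num), Real.rpow_neg two_pos.le,
            Real.rpow_natCast, div_inv_eq_mul, mul_comm]
  calc _ = (1 + R / 2) ^ (-(d : ℝ)) * (Real.log (2 + R / 2) ^ (-(1 / 2) : ℝ) *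
        Real.log (2 + R) ^ (1 / 2 : ℝ)) := by unfold criticalProfile; ring
    _ ≤ (2 ^ d * (1 + R) ^ (-(d : ℝ))) * 2 :=
        mul_le_mul hpow hlog' (by positivity) (by positivity)
    _ = _ := by ring

lemma integrableOn_integral_pow_mul_nearMajorant {d : ℕ} (hd : 1 ≤ d) {R : ℝ} (hR : 0 ≤ R) :
    IntegrableOn (fun r : ℝ ↦ r ^ (d - 1) * nearMajorant d R r) (Set.Ioi 0) ∧
    ∫ r in Set.Ioi (0 : ℝ), r ^ (d - 1) * nearMajorant d R r ≤
      (8 * 2 ^ d + 2) * (1 + R) ^ (-(d : ℝ)) := by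
  have hp : 0 ≤ criticalProfile d (R / 2) := criticalProfile_nonneg d (by linarith)
  have hm : Measurable fun r : ℝ ↦ r ^ (d - 1) * nearMajorant d R r :=
    (measurable_id.pow_const _).mul (measurable_nearMajorant d R)
  have hnn : ∀ r : ℝ, 0 ≤ r → 0 ≤ r ^ (d - 1) * nearMajorant d R r := fun r hr ↦
    mul_nonneg (pow_nonneg hr _) (nearMajorant_nonneg d hR hr)
  obtain ⟨hi1, hb1⟩ := integrableOn_integral_inv_mul_log_rpow hR
  obtain ⟨hi2, hb2⟩ := integrableOn_integral_one_add_rpow hd hR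
  have hle1 : ∀ r ∈ Set.Ioc 0 R, r ^ (d - 1) * nearMajorant d R r ≤
      criticalProfile d (R / 2) * (2 * ((2 + r)⁻¹ * Real.log (2 + r) ^ (-(1 / 2) : ℝ))) := by
    intro r hr
    have hl := Real.rpow_nonneg (log_two_add_pos hr.1.le).le (-(1 / 2) : ℝ)
    have h1 := pow_pred_mul_rpow_neg_le hd hr.1.le d
    rw [show (d : ℝ) - 1 - d = -1 by ring, Real.rpow_neg_one] at h1
    have h2 : (1 + r)⁻¹ ≤ 2 * (2 + r)⁻¹ := by
      have := hr.1
      rw [← div_eq_mul_inv, inv_eq_one_div, div_le_div_iff₀ (by linarith) (by linarith)]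
      linarith
    rw [nearMajorant, if_pos hr.2]
    calc _ = criticalProfile d (R / 2) * ((r ^ (d - 1) * (1 + r) ^ (-(d : ℝ))) *
          Real.log (2 + r) ^ (-(1 / 2) : ℝ)) := by rw [criticalProfile.eq_def d r]; ring
      _ ≤ criticalProfile d (R / 2) * ((2 * (2 + r)⁻¹) *
          Real.log (2 + r) ^ (-(1 / 2) : ℝ)) :=
        mul_le_mul_of_nonneg_left (mul_le_mul_of_nonneg_right (h1.trans h2) hl) hp
      _ = _ := by ring
  have hle2 : ∀ r ∈ Set.Ioi R, r ^ (d - 1) * nearMajorant d R r ≤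
      2 * (1 + r) ^ (-(d : ℝ) - 1) := by
    intro r hr
    have hr' := Set.mem_Ioi.1 hr
    have h1 := pow_pred_mul_rpow_neg_le hd (hR.trans hr'.le) (2 * d)
    rw [show (d : ℝ) - 1 - 2 * d = -(d : ℝ) - 1 by ring] at h1
    rw [nearMajorant, if_neg hr'.not_ge]
    linarith
  have hI1 : IntegrableOn (fun r : ℝ ↦ r ^ (d - 1) * nearMajorant d R r) (Set.Ioc 0 R) := by
    refine Integrable.mono' (hi1.const_mul (criticalProfile d (R / 2)))
      hm.aestronglyMeasurable (ae_restrict_of_forall_mem measurableSet_Ioc fun r hr ↦ ?_)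
    rw [Real.norm_of_nonneg (hnn r hr.1.le)]
    exact hle1 r hr
  have hI2 : IntegrableOn (fun r : ℝ ↦ r ^ (d - 1) * nearMajorant d R r) (Set.Ioi R) := by
    refine Integrable.mono' hi2
      hm.aestronglyMeasurable (ae_restrict_of_forall_mem measurableSet_Ioi fun r hr ↦ ?_)
    rw [Real.norm_of_nonneg (hnn r (hR.trans (Set.mem_Ioi.1 hr).le))]
    exact hle2 r hr
  rw [← Set.Ioc_union_Ioi_eq_Ioi hR]
  refine ⟨hI1.union hI2, ?_⟩
  rw [setIntegral_union (Set.Ioc_disjoint_Ioi le_rfl) measurableSet_Ioi hI1 hI2]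
  have e1 := setIntegral_mono_on hI1 (hi1.const_mul (criticalProfile d (R / 2)))
    measurableSet_Ioc hle1
  have e2 := setIntegral_mono_on hI2 hi2 measurableSet_Ioi hle2
  rw [integral_const_mul] at e1
  have e3 := mul_le_mul_of_nonneg_left hb1 hp
  have e4 := criticalProfile_half_mul_log_rpow_le d hR
  linarith

lemma integrable_integral_nearMajorant_norm {d : ℕ} (hd : 1 ≤ d) {R : ℝ} (hR : 0 ≤ R) :
    Integrable (fun y : EuclideanSpace ℝ (Fin d) ↦ nearMajorant d R ‖y‖) ∧
    ∫ y : EuclideanSpace ℝ (Fin d), nearMajorant d R ‖y‖ ≤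
      d * volume.real (Metric.ball (0 : EuclideanSpace ℝ (Fin d)) 1) *
        ((8 * 2 ^ d + 2) * (1 + R) ^ (-(d : ℝ))) := by
  have : Nonempty (Fin d) := ⟨⟨0, hd⟩⟩
  obtain ⟨hi, hb⟩ := integrableOn_integral_pow_mul_nearMajorant hd hR
  refine ⟨(integrable_fun_norm_addHaar volume).2 (by simpa using hi), ?_⟩
  rw [integral_fun_norm_addHaar volume]
  simp only [finrank_euclideanSpace, Fintype.card_fin, nsmul_eq_mul, smul_eq_mul]
  rw [mul_assoc]
  gcongr

theorem stmt_5 (d : ℕ) (hd : 1 ≤ d) :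
    ∃ C : ℝ, 0 < C ∧ ∀ x : EuclideanSpace ℝ (Fin d),
      ∫ y : EuclideanSpace ℝ (Fin d),
          (1 + ‖x - y‖) ^ (-(d : ℝ)) * Real.log (2 + ‖x - y‖) ^ (-(1 / 2) : ℝ) *
            ((1 + ‖y‖) ^ (-(d : ℝ)) * Real.log (2 + ‖y‖) ^ (-(1 / 2) : ℝ)) ≤
        C * (1 + ‖x‖) ^ (-(d : ℝ)) := by
  set K : ℝ := d * volume.real (Metric.ball (0 : EuclideanSpace ℝ (Fin d)) 1) with hK
  have hK0 : 0 ≤ K := by positivity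
  refine ⟨2 * (K * (8 * 2 ^ d + 2)) + 1, by positivity, fun x ↦ ?_⟩
  obtain ⟨hi, hb⟩ := integrable_integral_nearMajorant_norm hd (norm_nonneg x)
  have hi' := hi.comp_sub_left x
  calc _ = ∫ y : EuclideanSpace ℝ (Fin d), criticalProfile d ‖x - y‖ * criticalProfile d ‖y‖ := rfl
    _ ≤ ∫ y : EuclideanSpace ℝ (Fin d),
        (nearMajorant d ‖x‖ ‖y‖ + nearMajorant d ‖x‖ ‖x - y‖) := by
      refine integral_mono_of_nonneg (.of_forall fun y ↦ ?_) (hi.add hi') (.of_forall fun y ↦ ?_)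
      · exact mul_nonneg (criticalProfile_nonneg d (norm_nonneg _))
          (criticalProfile_nonneg d (norm_nonneg _))
      · have h1 := nearMajorant_nonneg d (norm_nonneg x) (norm_nonneg y)
        have h2 := nearMajorant_nonneg d (norm_nonneg x) (norm_nonneg (x - y))
        have h3 : ‖x‖ ≤ ‖x - y‖ + ‖y‖ := by simpa using norm_add_le (x - y) y
        dsimp only
        rcases le_total ‖y‖ ‖x - y‖ with h | h
        · linarith [criticalProfile_mul_le_nearMajorant d (norm_nonneg x) (norm_nonneg y) h
            (by linarith)]
        · have := criticalProfile_mul_le_nearMajorant d (norm_nonneg x) (norm_nonneg (x - y)) h h3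
          rw [mul_comm]
          linarith
    _ = 2 * ∫ y : EuclideanSpace ℝ (Fin d), nearMajorant d ‖x‖ ‖y‖ := by
      rw [integral_add hi hi',
        integral_sub_left_eq_self (fun y ↦ nearMajorant d ‖x‖ ‖y‖) volume x, two_mul]
    _ ≤ _ := by
      have : 0 ≤ (1 + ‖x‖) ^ (-(d : ℝ)) := by positivity
      linarith
end

section
/- Let d ≥ 1. There exists a constant C depending only on d such that for every x ∈ ℝ^d, ∫_{ℝ^d} (1+|x−y|)^{−d} (1+|y|)^{−d} log(2+|y|)^{−1/2} dy ≤ C (1+|x|)^{−d} log(2+|x|)^{1/2}. -/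
open MeasureTheory

lemma pow_mul_one_add_rpow_neg_le {d : ℕ} (hd : 1 ≤ d) {t : ℝ} (ht : 0 ≤ t) :
    t ^ (d - 1) * (1 + t) ^ (-(d : ℝ)) ≤ (1 + t)⁻¹ := by
  have h1 : (0 : ℝ) < 1 + t := by linarith
  have h2 : t ^ (d - 1) ≤ (1 + t) ^ (d - 1) := by gcongr; linarith
  have h3 : (1 + t) ^ (d - 1) * (1 + t) ^ (-(d : ℝ)) = (1 + t)⁻¹ := by
    rw [← Real.rpow_natCast, ← Real.rpow_add h1, ← Real.rpow_neg_one]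
    congr 1
    push_cast [hd]
    ring
  rw [← h3]
  gcongr

lemma log_two_add_pos_s6 {t : ℝ} (ht : 0 ≤ t) : 0 < Real.log (2 + t) :=
  Real.log_pos (by linarith)

lemma half_le_log_two_add {t : ℝ} (ht : 0 ≤ t) : 1 / 2 ≤ Real.log (2 + t) := by
  have h : Real.log 2 ≤ Real.log (2 + t) := Real.log_le_log (by norm_num) (by linarith)
  linarith [Real.log_two_gt_d9]

lemma half_le_log_two_add_rpow_half {t : ℝ} (ht : 0 ≤ t) :
    1 / 2 ≤ Real.log (2 + t) ^ ((1 / 2) : ℝ) := by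
  rw [← Real.sqrt_eq_rpow]
  apply Real.le_sqrt_of_sq_le
  linarith [half_le_log_two_add ht]

lemma log_two_add_rpow_neg_half_le_two {t : ℝ} (ht : 0 ≤ t) :
    Real.log (2 + t) ^ (-(1 / 2) : ℝ) ≤ 2 := by
  rw [Real.rpow_neg (log_two_add_pos_s6 ht).le]
  exact inv_le_of_inv_le₀ (by norm_num) (by
    simpa using half_le_log_two_add_rpow_half ht)

/-- The radial profile `(1 + t)^{-d} log(2 + t)^{-1/2}`. -/
noncomputable def logProfile (d : ℕ) (t : ℝ) : ℝ :=
  (1 + t) ^ (-(d : ℝ)) * Real.log (2 + t) ^ (-(1 / 2) : ℝ)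

lemma logProfile_nonneg (d : ℕ) {t : ℝ} (ht : 0 ≤ t) : 0 ≤ logProfile d t :=
  mul_nonneg (Real.rpow_nonneg (by linarith) _) (Real.rpow_nonneg (log_two_add_pos_s6 ht).le _)

lemma continuousOn_one_add_rpow (a : ℝ) :
    ContinuousOn (fun t : ℝ ↦ (1 + t) ^ a) (Set.Ici 0) := by
  intro t (ht : 0 ≤ t)
  exact (ContinuousAt.rpow_const (by fun_prop) (Or.inl (by positivity))).continuousWithinAt

lemma continuousOn_log_two_add_rpow (a : ℝ) :
    ContinuousOn (fun t : ℝ ↦ Real.log (2 + t) ^ a) (Set.Ici 0) := by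
  intro t (ht : 0 ≤ t)
  refine (ContinuousAt.rpow_const (ContinuousAt.log (by fun_prop) (by positivity))
    (Or.inl (log_two_add_pos_s6 ht).ne')).continuousWithinAt

lemma integrableOn_pow_mul_logProfile (d : ℕ) (r : ℝ) :
    IntegrableOn (fun t ↦ t ^ (d - 1) * logProfile d t) (Set.Ioc 0 r) := by
  have h : ContinuousOn (fun t ↦ t ^ (d - 1) * logProfile d t) (Set.Icc 0 r) :=
    (((continuous_pow _).continuousOn).mul ((continuousOn_one_add_rpow _).mul
      (continuousOn_log_two_add_rpow _))).mono Set.Icc_subset_Ici_self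
  exact h.integrableOn_Icc.mono_set Set.Ioc_subset_Icc_self

lemma integral_pow_mul_logProfile_le {d : ℕ} (hd : 1 ≤ d) {r : ℝ} (hr : 0 ≤ r) :
    ∫ t in Set.Ioc 0 r, t ^ (d - 1) * logProfile d t ≤
      4 * Real.log (2 + r) ^ ((1 / 2) : ℝ) := by
  set g : ℝ → ℝ := fun t ↦ 2 * ((2 + t)⁻¹ * Real.log (2 + t) ^ (-(1 / 2) : ℝ)) with hg
  have hgc : ContinuousOn g (Set.Icc 0 r) := by
    refine continuousOn_const.mul (ContinuousOn.mul ?_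
      ((continuousOn_log_two_add_rpow _).mono Set.Icc_subset_Ici_self))
    exact ContinuousOn.inv₀ (by fun_prop) fun t ht ↦ by linarith [ht.1]
  have hderiv : ∀ t ∈ Set.uIcc 0 r,
      HasDerivAt (fun t ↦ 4 * Real.log (2 + t) ^ ((1 / 2) : ℝ)) (g t) t := by
    intro t ht
    rw [Set.uIcc_of_le hr] at ht
    have h1 : HasDerivAt (fun t : ℝ ↦ 2 + t) 1 t := (hasDerivAt_id t).const_add 2
    have h2 := ((h1.log (by linarith [ht.1])).rpow_const (p := 1 / 2)
      (Or.inl (log_two_add_pos_s6 ht.1).ne')).const_mul 4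
    refine h2.congr_deriv ?_
    rw [hg, show (1 / 2 - 1 : ℝ) = -(1 / 2) by norm_num]
    ring
  have hgI : ∫ t in Set.Ioc 0 r, g t =
      4 * Real.log (2 + r) ^ ((1 / 2) : ℝ) - 4 * Real.log (2 + 0) ^ ((1 / 2) : ℝ) := by
    rw [← intervalIntegral.integral_of_le hr]
    refine intervalIntegral.integral_eq_sub_of_hasDerivAt hderiv ?_
    exact ContinuousOn.intervalIntegrable (by rwa [Set.uIcc_of_le hr])
  have hle : ∫ t in Set.Ioc 0 r, t ^ (d - 1) * logProfile d t ≤ ∫ t in Set.Ioc 0 r, g t := by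
    refine setIntegral_mono_on (integrableOn_pow_mul_logProfile d r)
      (hgc.integrableOn_Icc.mono_set Set.Ioc_subset_Icc_self) measurableSet_Ioc ?_
    intro t ht
    have ht0 : 0 ≤ t := ht.1.le
    have h1 := pow_mul_one_add_rpow_neg_le hd ht0
    have h2 : (1 + t)⁻¹ ≤ 2 * (2 + t)⁻¹ := by
      rw [← div_eq_mul_inv, inv_eq_one_div, div_le_div_iff₀ (by linarith) (by linarith)]
      linarith
    have h3 : 0 ≤ Real.log (2 + t) ^ (-(1 / 2) : ℝ) :=
      Real.rpow_nonneg (log_two_add_pos_s6 ht0).le _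
    calc t ^ (d - 1) * logProfile d t
        = t ^ (d - 1) * (1 + t) ^ (-(d : ℝ)) * Real.log (2 + t) ^ (-(1 / 2) : ℝ) := by
          rw [logProfile]; ring
      _ ≤ 2 * (2 + t)⁻¹ * Real.log (2 + t) ^ (-(1 / 2) : ℝ) := by
          exact mul_le_mul_of_nonneg_right (h1.trans h2) h3
      _ = g t := by rw [hg]; ring
  have := half_le_log_two_add_rpow_half le_rfl
  linarith

lemma pow_mul_one_add_rpow_neg_mul_self_le {d : ℕ} (hd : 1 ≤ d) {t : ℝ} (ht : 0 ≤ t) :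
    t ^ (d - 1) * ((1 + t) ^ (-(d : ℝ)) * (1 + t) ^ (-(d : ℝ))) ≤
      (t + 1) ^ (-(d : ℝ) - 1) := by
  have h1 : (0 : ℝ) < 1 + t := by linarith
  rw [← mul_assoc, add_comm t 1, Real.rpow_sub_one h1.ne', div_eq_inv_mul]
  have := pow_mul_one_add_rpow_neg_le hd ht
  gcongr

lemma integrableOn_pow_mul_one_add_rpow_neg_mul_self {d : ℕ} (hd : 1 ≤ d) {r : ℝ} (hr : 0 ≤ r) :
    IntegrableOn (fun t : ℝ ↦ t ^ (d - 1) * ((1 + t) ^ (-(d : ℝ)) * (1 + t) ^ (-(d : ℝ))))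
      (Set.Ioi r) := by
  have hd' : (1 : ℝ) ≤ d := by exact_mod_cast hd
  refine Integrable.mono' (integrableOn_add_rpow_Ioi_of_lt (a := -(d : ℝ) - 1) (m := 1)
    (by linarith) (by linarith)) ?_ ?_
  · refine ContinuousOn.aestronglyMeasurable ?_ measurableSet_Ioi
    exact (((continuous_pow _).continuousOn).mul ((continuousOn_one_add_rpow _).mul
      (continuousOn_one_add_rpow _))).mono fun t ht ↦ hr.trans (le_of_lt ht)
  · refine (ae_restrict_iff' measurableSet_Ioi).2 (ae_of_all _ fun t ht ↦ ?_)
    have ht0 : 0 ≤ t := hr.trans (le_of_lt ht)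
    rw [Real.norm_of_nonneg (by positivity)]
    exact pow_mul_one_add_rpow_neg_mul_self_le hd ht0

lemma integral_pow_mul_one_add_rpow_neg_mul_self_le {d : ℕ} (hd : 1 ≤ d) {r : ℝ} (hr : 0 ≤ r) :
    ∫ t in Set.Ioi r, t ^ (d - 1) * ((1 + t) ^ (-(d : ℝ)) * (1 + t) ^ (-(d : ℝ))) ≤
      (1 + r) ^ (-(d : ℝ)) := by
  have hd' : (1 : ℝ) ≤ d := by exact_mod_cast hd
  have hI : ∫ t in Set.Ioi r, (t + 1) ^ (-(d : ℝ) - 1) = (1 + r) ^ (-(d : ℝ)) / d := by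
    have hshift := (measurePreserving_add_right volume (1 : ℝ)).setIntegral_preimage_emb
      (measurableEmbedding_addRight 1) (fun t : ℝ ↦ t ^ (-(d : ℝ) - 1)) (Set.Ioi (r + 1))
    rw [Set.preimage_add_const_Ioi, add_sub_cancel_right] at hshift
    rw [hshift, integral_Ioi_rpow_of_lt (by linarith) (by linarith), add_comm r 1]
    simp [neg_div_neg_eq]
  calc _ ≤ ∫ t in Set.Ioi r, (t + 1) ^ (-(d : ℝ) - 1) :=
        setIntegral_mono_on (integrableOn_pow_mul_one_add_rpow_neg_mul_self hd hr)
          (integrableOn_add_rpow_Ioi_of_lt (by linarith) (by linarith)) measurableSet_Ioi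
          fun t ht ↦ pow_mul_one_add_rpow_neg_mul_self_le hd (hr.trans (le_of_lt ht))
    _ = (1 + r) ^ (-(d : ℝ)) / d := hI
    _ ≤ _ := div_le_self (by positivity) hd'

/-- A radial majorant for the part of the convolution integrand where `‖y‖ ≤ ‖x - y‖`,
with `r = ‖x‖`. -/
noncomputable def radialMajorant (d : ℕ) (r t : ℝ) : ℝ :=
  if t ≤ r then 2 ^ d * (1 + r) ^ (-(d : ℝ)) * logProfile d t
  else 2 * ((1 + t) ^ (-(d : ℝ)) * (1 + t) ^ (-(d : ℝ)))

lemma radialMajorant_nonneg (d : ℕ) {r t : ℝ} (hr : 0 ≤ r) (ht : 0 ≤ t) :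
    0 ≤ radialMajorant d r t := by
  have := logProfile_nonneg d ht
  unfold radialMajorant
  split_ifs <;> positivity

lemma integrableOn_and_integral_pow_mul_radialMajorant_le {d : ℕ} (hd : 1 ≤ d) {r : ℝ}
    (hr : 0 ≤ r) :
    IntegrableOn (fun t ↦ t ^ (d - 1) * radialMajorant d r t) (Set.Ioi 0) ∧
      ∫ t in Set.Ioi 0, t ^ (d - 1) * radialMajorant d r t ≤
        (4 * 2 ^ d + 4) * ((1 + r) ^ (-(d : ℝ)) * Real.log (2 + r) ^ ((1 / 2) : ℝ)) := by
  have e1 : Set.EqOn (fun t ↦ 2 ^ d * (1 + r) ^ (-(d : ℝ)) * (t ^ (d - 1) * logProfile d t))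
      (fun t ↦ t ^ (d - 1) * radialMajorant d r t) (Set.Ioc 0 r) := by
    intro t ht
    simp only [radialMajorant, if_pos ht.2]
    ring
  have e2 : Set.EqOn
      (fun t ↦ 2 * (t ^ (d - 1) * ((1 + t) ^ (-(d : ℝ)) * (1 + t) ^ (-(d : ℝ)))))
      (fun t ↦ t ^ (d - 1) * radialMajorant d r t) (Set.Ioi r) := by
    intro t ht
    simp only [radialMajorant, if_neg (not_le.2 (Set.mem_Ioi.1 ht))]
    ring
  have i1 : IntegrableOn (fun t ↦ t ^ (d - 1) * radialMajorant d r t) (Set.Ioc 0 r) :=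
    IntegrableOn.congr_fun ((integrableOn_pow_mul_logProfile d r).const_mul _) e1
      measurableSet_Ioc
  have i2 : IntegrableOn (fun t ↦ t ^ (d - 1) * radialMajorant d r t) (Set.Ioi r) :=
    IntegrableOn.congr_fun
      ((integrableOn_pow_mul_one_add_rpow_neg_mul_self hd hr).const_mul _) e2 measurableSet_Ioi
  rw [← Set.Ioc_union_Ioi_eq_Ioi hr]
  refine ⟨i1.union i2, ?_⟩
  rw [setIntegral_union Set.Ioc_disjoint_Ioi_same measurableSet_Ioi i1 i2,
    ← setIntegral_congr_fun measurableSet_Ioc e1, ← setIntegral_congr_fun measurableSet_Ioi e2,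
    integral_const_mul, integral_const_mul]
  have h1 := integral_pow_mul_logProfile_le hd hr
  have h2 := integral_pow_mul_one_add_rpow_neg_mul_self_le hd hr
  have h3 := half_le_log_two_add_rpow_half hr
  have h4 : 0 ≤ (1 + r) ^ (-(d : ℝ)) := by positivity
  have h5 := mul_le_mul_of_nonneg_left h1 (show 0 ≤ 2 ^ d * (1 + r) ^ (-(d : ℝ)) by positivity)
  have h6 := mul_le_mul_of_nonneg_left h3 h4
  linarith

lemma one_add_rpow_neg_mul_logProfile_le (d : ℕ) {E : Type*} [NormedAddCommGroup E] (x y : E)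
    (h : ‖y‖ ≤ ‖x - y‖) :
    (1 + ‖x - y‖) ^ (-(d : ℝ)) * logProfile d ‖y‖ ≤ radialMajorant d ‖x‖ ‖y‖ := by
  have hy := norm_nonneg y
  have hx := norm_nonneg x
  have hf := logProfile_nonneg d hy
  have hd : -(d : ℝ) ≤ 0 := by simp
  unfold radialMajorant
  split_ifs with hyx
  · have h1 : ‖x‖ ≤ ‖x - y‖ + ‖y‖ := by simpa using norm_add_le (x - y) y
    have h2 : (1 + ‖x - y‖) ^ (-(d : ℝ)) ≤ ((1 + ‖x‖) / 2) ^ (-(d : ℝ)) :=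
      Real.rpow_le_rpow_of_nonpos (by positivity) (by linarith) hd
    have h3 : ((1 + ‖x‖) / 2) ^ (-(d : ℝ)) = 2 ^ d * (1 + ‖x‖) ^ (-(d : ℝ)) := by
      rw [Real.div_rpow (by positivity) (by norm_num), Real.rpow_neg (by norm_num : (0 : ℝ) ≤ 2),
        Real.rpow_natCast, div_inv_eq_mul, mul_comm]
    rw [← h3]
    gcongr
  · have h1 : (1 + ‖x - y‖) ^ (-(d : ℝ)) ≤ (1 + ‖y‖) ^ (-(d : ℝ)) :=
      Real.rpow_le_rpow_of_nonpos (by positivity) (by linarith) hd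
    have h2 := log_two_add_rpow_neg_half_le_two hy
    calc _ ≤ (1 + ‖y‖) ^ (-(d : ℝ)) * ((1 + ‖y‖) ^ (-(d : ℝ)) * 2) := by
          rw [logProfile] at *
          gcongr
      _ = _ := by ring

/-- The product `(1 + a)^{-d} (1 + b)^{-d}` times `log(2 + ·)^{-1/2}` is largest when the
logarithm is evaluated at the smaller argument. -/
lemma one_add_rpow_neg_mul_logProfile_le_swap (d : ℕ) {a b : ℝ} (ha : 0 ≤ a) (h : a ≤ b) :
    (1 + a) ^ (-(d : ℝ)) * logProfile d b ≤ (1 + b) ^ (-(d : ℝ)) * logProfile d a := by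
  have hb : 0 ≤ b := ha.trans h
  have h1 : Real.log (2 + b) ^ (-(1 / 2) : ℝ) ≤ Real.log (2 + a) ^ (-(1 / 2) : ℝ) :=
    Real.rpow_le_rpow_of_nonpos (log_two_add_pos_s6 ha)
      (Real.log_le_log (by linarith) (by linarith)) (by norm_num)
  have h2 : 0 ≤ (1 + a) ^ (-(d : ℝ)) * (1 + b) ^ (-(d : ℝ)) := by positivity
  have h3 := mul_le_mul_of_nonneg_left h1 h2
  unfold logProfile
  linarith

lemma one_add_rpow_neg_mul_logProfile_le_add (d : ℕ) {E : Type*} [NormedAddCommGroup E]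
    (x y : E) :
    (1 + ‖x - y‖) ^ (-(d : ℝ)) * logProfile d ‖y‖ ≤
      radialMajorant d ‖x‖ ‖y‖ + radialMajorant d ‖x‖ ‖x - y‖ := by
  have hK1 := radialMajorant_nonneg d (norm_nonneg x) (norm_nonneg y)
  have hK2 := radialMajorant_nonneg d (norm_nonneg x) (norm_nonneg (x - y))
  rcases le_total ‖y‖ ‖x - y‖ with h | h
  · linarith [one_add_rpow_neg_mul_logProfile_le d x y h]
  · have h1 := one_add_rpow_neg_mul_logProfile_le_swap d (norm_nonneg (x - y)) h
    have h2 := one_add_rpow_neg_mul_logProfile_le d x (x - y) (by simpa using h)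
    rw [sub_sub_cancel] at h2
    linarith

theorem stmt_6 (d : ℕ) (hd : 1 ≤ d) :
    ∃ C : ℝ, 0 < C ∧ ∀ x : EuclideanSpace ℝ (Fin d),
      ∫ y : EuclideanSpace ℝ (Fin d),
          (1 + ‖x - y‖) ^ (-(d : ℝ)) *
            ((1 + ‖y‖) ^ (-(d : ℝ)) * Real.log (2 + ‖y‖) ^ (-(1 / 2) : ℝ)) ≤
        C * (1 + ‖x‖) ^ (-(d : ℝ)) * Real.log (2 + ‖x‖) ^ ((1 / 2) : ℝ) := by
  have : Nontrivial (EuclideanSpace ℝ (Fin d)) :=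
    Module.nontrivial_of_finrank_pos (R := ℝ) (by rw [finrank_euclideanSpace_fin]; omega)
  set V : ℝ := volume.real (Metric.ball (0 : EuclideanSpace ℝ (Fin d)) 1) with hV
  have hVpos : 0 < V :=
    ENNReal.toReal_pos (Metric.measure_ball_pos _ _ one_pos).ne' measure_ball_lt_top.ne
  have hd' : (0 : ℝ) < d := by exact_mod_cast hd
  refine ⟨2 * (d * (V * (4 * 2 ^ d + 4))), by positivity, fun x ↦ ?_⟩
  obtain ⟨hint, hle⟩ := integrableOn_and_integral_pow_mul_radialMajorant_le hd (norm_nonneg x)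
  have hK : Integrable (fun y : EuclideanSpace ℝ (Fin d) ↦ radialMajorant d ‖x‖ ‖y‖) := by
    rw [integrable_fun_norm_addHaar volume (f := radialMajorant d ‖x‖)]
    simpa only [finrank_euclideanSpace_fin, smul_eq_mul] using hint
  have hKI : ∫ y : EuclideanSpace ℝ (Fin d), radialMajorant d ‖x‖ ‖y‖ ≤
      d * (V * ((4 * 2 ^ d + 4) *
        ((1 + ‖x‖) ^ (-(d : ℝ)) * Real.log (2 + ‖x‖) ^ ((1 / 2) : ℝ)))) := by
    rw [integral_fun_norm_addHaar volume (radialMajorant d ‖x‖)]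
    simp only [finrank_euclideanSpace_fin, smul_eq_mul, nsmul_eq_mul]
    gcongr
  calc _ ≤ ∫ y : EuclideanSpace ℝ (Fin d),
        (radialMajorant d ‖x‖ ‖y‖ + radialMajorant d ‖x‖ ‖x - y‖) := by
        refine integral_mono_of_nonneg (ae_of_all _ fun y ↦ ?_)
          (hK.add (hK.comp_sub_left x))
          (ae_of_all _ fun y ↦ one_add_rpow_neg_mul_logProfile_le_add d x y)
        exact mul_nonneg (by positivity) (logProfile_nonneg d (norm_nonneg y))
    _ = 2 * ∫ y : EuclideanSpace ℝ (Fin d), radialMajorant d ‖x‖ ‖y‖ := by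
        rw [integral_add hK (hK.comp_sub_left x),
          integral_sub_left_eq_self (fun y ↦ radialMajorant d ‖x‖ ‖y‖) volume x, two_mul]
    _ ≤ _ := by linarith
end

section
/- Let d ≥ 1. There exists a constant C depending only on d such that for every x ∈ ℝ^d, ∫_{ℝ^d} log(2+|x+z|)^{1/2} (1+|x+z|)^{−d} · log(2+|z|)^{1/2} (1+|z|)^{−d} dz ≤ C (1+|x|)^{−d} log(2+|x|)^{2}. -/
open MeasureTheory

open Set Filter Topology in
theorem integral_Ioi_one_add_rpow {s : ℝ} (hs : 0 < s) :
    ∫ t in Ioi (0 : ℝ), (t + 1) ^ (-1 - s) = s⁻¹ := by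
  have hd : ∀ x ∈ Ici (0 : ℝ),
      HasDerivAt (fun t ↦ (t + 1) ^ (-s) / (-s)) ((x + 1) ^ (-1 - s)) x := by
    intro x hx
    have hx' : (0 : ℝ) ≤ x := hx
    have h := (((hasDerivAt_id x).add_const (1 : ℝ)).rpow_const (p := -s)
      (Or.inl (by simp only [id]; linarith))).div_const (-s)
    refine h.congr_deriv ?_
    rw [show -s - 1 = -1 - s by ring, id]
    field_simp
  have ht : Tendsto (fun t : ℝ ↦ (t + 1) ^ (-s) / (-s)) atTop (𝓝 (0 / (-s))) :=
    ((tendsto_rpow_neg_atTop hs).comp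
      (tendsto_atTop_add_const_right _ 1 tendsto_id)).div_const _
  rw [integral_Ioi_of_hasDerivAt_of_tendsto' hd
    (integrableOn_add_rpow_Ioi_of_lt (by linarith) (by norm_num)) ht]
  simp

open Set Module in
/-- The integral of `(1 + ‖z‖) ^ (-(n + s))`, `n` the dimension, is `O(1 / s)`. -/
theorem integral_one_add_norm_rpow_le_s7 {E : Type*} [NormedAddCommGroup E] [NormedSpace ℝ E]
    [FiniteDimensional ℝ E] [Nontrivial E] [MeasurableSpace E] [BorelSpace E]
    (μ : Measure E) [μ.IsAddHaarMeasure] {s : ℝ} (hs : 0 < s) :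
    ∫ z : E, (1 + ‖z‖) ^ (-((finrank ℝ E : ℝ) + s)) ∂μ ≤
      finrank ℝ E * μ.real (Metric.ball 0 1) / s := by
  rw [integral_fun_norm_addHaar μ (fun r : ℝ ↦ (1 + r) ^ (-((finrank ℝ E : ℝ) + s)))]
  have key : ∫ y in Ioi (0 : ℝ),
      y ^ (finrank ℝ E - 1) • (1 + y) ^ (-((finrank ℝ E : ℝ) + s)) ≤ s⁻¹ := by
    rw [← integral_Ioi_one_add_rpow hs]
    apply integral_mono_of_nonneg
    · filter_upwards [ae_restrict_mem measurableSet_Ioi] with y hy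
      have : 0 < y := hy
      simp only [Pi.zero_apply, smul_eq_mul]
      positivity
    · exact integrableOn_add_rpow_Ioi_of_lt (by linarith) (by norm_num)
    · filter_upwards [ae_restrict_mem measurableSet_Ioi] with y hy
      have hy : 0 < y := hy
      have hn : 1 ≤ finrank ℝ E := finrank_pos
      simp only [smul_eq_mul]
      calc y ^ (finrank ℝ E - 1) * (1 + y) ^ (-((finrank ℝ E : ℝ) + s))
          ≤ (1 + y) ^ (finrank ℝ E - 1) * (1 + y) ^ (-((finrank ℝ E : ℝ) + s)) := by
            gcongr
            linarith
        _ = (y + 1) ^ (-1 - s) := by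
            rw [← Real.rpow_natCast, ← Real.rpow_add (by linarith), Nat.cast_sub hn, add_comm y 1]
            congr 1
            push_cast
            ring
  rw [nsmul_eq_mul, smul_eq_mul, div_eq_mul_inv, mul_assoc]
  gcongr

theorem half_lt_log_two_add {r : ℝ} (hr : 0 ≤ r) : 1 / 2 < Real.log (2 + r) := by
  have h1 := Real.log_two_gt_d9
  have h2 : Real.log 2 ≤ Real.log (2 + r) := Real.log_le_log (by norm_num) (by linarith)
  linarith

theorem log_two_add_le_mul_sqrt {r a : ℝ} (hr : 0 ≤ r) (ha : 0 ≤ a) (h : 1 + r ≤ 2 * (1 + a)) :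
    Real.log (2 + a) ≤ 6 * Real.log (2 + r) * √((1 + a) / (1 + r)) := by
  set t := (1 + a) / (1 + r) with ht
  have ht2 : 1 / 2 ≤ t := by rw [ht, le_div_iff₀ (by linarith)]; linarith
  have hs : 1 / 2 ≤ √t := Real.le_sqrt_of_sq_le (by linarith)
  have hL := half_lt_log_two_add hr
  have hat : t * (1 + r) = 1 + a := by rw [ht]; field_simp
  have h1 : Real.log (2 + a) ≤ Real.log (2 + r) + Real.log (1 + t) := by
    rw [← Real.log_mul (by linarith) (by linarith)]
    exact Real.log_le_log (by linarith) (by nlinarith)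
  have h2 : Real.log (1 + t) ≤ 2 * √t := by
    have h3 : Real.log (1 + t) ≤ Real.log ((1 + √t) ^ 2) :=
      Real.log_le_log (by linarith) (by nlinarith [Real.sq_sqrt (show 0 ≤ t by linarith)])
    rw [Real.log_pow] at h3
    have h4 := Real.log_le_sub_one_of_pos (show 0 < 1 + √t by linarith)
    push_cast at h3
    linarith
  nlinarith

theorem log_rpow_mul_le_of_le {d r a b s : ℝ} (hd : 1 ≤ d) (hr : 0 ≤ r) (hb : 0 ≤ b) (hba : b ≤ a)
    (h : r ≤ a + b) (hs : 0 ≤ s) (hs' : s ≤ 1 / 2) (hrs : (1 + r) ^ s ≤ 2) :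
    Real.log (2 + a) ^ ((1 / 2) : ℝ) * (1 + a) ^ (-d) *
        (Real.log (2 + b) ^ ((1 / 2) : ℝ) * (1 + b) ^ (-d)) ≤
      12 * 2 ^ d * Real.log (2 + r) * (1 + r) ^ (-d) * (1 + b) ^ (-(d + s)) := by
  have ha : 0 ≤ a := hb.trans hba
  have hLa := half_lt_log_two_add ha
  have hLb := half_lt_log_two_add hb
  have hLr := half_lt_log_two_add hr
  have hA : 0 < 1 + a := by linarith
  have hB : 0 < 1 + b := by linarith
  have hR : 0 < 1 + r := by linarith
  have hlog : Real.log (2 + a) ^ ((1 / 2) : ℝ) * Real.log (2 + b) ^ ((1 / 2) : ℝ) ≤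
      Real.log (2 + a) := by
    calc _ ≤ Real.log (2 + a) ^ ((1 / 2) : ℝ) * Real.log (2 + a) ^ ((1 / 2) : ℝ) := by
          gcongr
      _ = Real.log (2 + a) := by
          rw [← Real.rpow_add (by linarith)]; norm_num
  have hmain : Real.log (2 + a) * (1 + a) ^ (-d) * (1 + b) ^ s ≤
      12 * 2 ^ d * Real.log (2 + r) * (1 + r) ^ (-d) := by
    have hpow : (1 + a) ^ (1 / 2 + s - d) ≤ 2 ^ d * (1 + r) ^ (1 / 2 + s - d) := by
      calc (1 + a) ^ (1 / 2 + s - d) ≤ ((1 + r) / 2) ^ (1 / 2 + s - d) :=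
            Real.rpow_le_rpow_of_nonpos (by linarith) (by linarith) (by linarith)
        _ = 2 ^ (-(1 / 2 + s - d)) * (1 + r) ^ (1 / 2 + s - d) := by
            rw [Real.div_rpow hR.le (by norm_num), Real.rpow_neg (by norm_num)]
            ring
        _ ≤ 2 ^ d * (1 + r) ^ (1 / 2 + s - d) := by
            gcongr
            · norm_num
            · linarith
    calc Real.log (2 + a) * (1 + a) ^ (-d) * (1 + b) ^ s
        ≤ (6 * Real.log (2 + r) * √((1 + a) / (1 + r))) * (1 + a) ^ (-d) * (1 + a) ^ s := by
          gcongr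
          exact log_two_add_le_mul_sqrt hr ha (by linarith)
      _ = 6 * Real.log (2 + r) * (1 + a) ^ (1 / 2 + s - d) * (1 + r) ^ (-(1 / 2) : ℝ) := by
          rw [Real.sqrt_eq_rpow, Real.div_rpow hA.le hR.le, Real.rpow_neg hR.le,
            show 1 / 2 + s - d = 1 / 2 + -d + s by ring, Real.rpow_add hA, Real.rpow_add hA]
          ring
      _ ≤ 6 * Real.log (2 + r) * (2 ^ d * (1 + r) ^ (1 / 2 + s - d)) *
            (1 + r) ^ (-(1 / 2) : ℝ) := by
          gcongr
      _ = 6 * Real.log (2 + r) * 2 ^ d * (1 + r) ^ (-d) * (1 + r) ^ s := by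
          have : (1 + r) ^ (1 / 2 + s - d) * (1 + r) ^ (-(1 / 2) : ℝ) =
              (1 + r) ^ (-d) * (1 + r) ^ s := by
            rw [← Real.rpow_add hR, ← Real.rpow_add hR]
            congr 1
            ring
          linear_combination 6 * Real.log (2 + r) * 2 ^ d * this
      _ ≤ 6 * Real.log (2 + r) * 2 ^ d * (1 + r) ^ (-d) * 2 := by
          gcongr
      _ = 12 * 2 ^ d * Real.log (2 + r) * (1 + r) ^ (-d) := by ring
  have hsplit : (1 + b) ^ (-d) = (1 + b) ^ s * (1 + b) ^ (-(d + s)) := by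
    rw [← Real.rpow_add hB]
    congr 1
    ring
  calc _ = (Real.log (2 + a) ^ ((1 / 2) : ℝ) * Real.log (2 + b) ^ ((1 / 2) : ℝ)) *
        (1 + a) ^ (-d) * (1 + b) ^ (-d) := by ring
    _ ≤ Real.log (2 + a) * (1 + a) ^ (-d) * (1 + b) ^ (-d) := by gcongr
    _ = Real.log (2 + a) * (1 + a) ^ (-d) * (1 + b) ^ s * (1 + b) ^ (-(d + s)) := by
        rw [hsplit]; ring
    _ ≤ _ := by gcongr

theorem log_rpow_mul_le {d r a b s : ℝ} (hd : 1 ≤ d) (hr : 0 ≤ r) (ha : 0 ≤ a) (hb : 0 ≤ b)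
    (h : r ≤ a + b) (hs : 0 ≤ s) (hs' : s ≤ 1 / 2) (hrs : (1 + r) ^ s ≤ 2) :
    Real.log (2 + a) ^ ((1 / 2) : ℝ) * (1 + a) ^ (-d) *
        (Real.log (2 + b) ^ ((1 / 2) : ℝ) * (1 + b) ^ (-d)) ≤
      12 * 2 ^ d * Real.log (2 + r) * (1 + r) ^ (-d) *
        ((1 + a) ^ (-(d + s)) + (1 + b) ^ (-(d + s))) := by
  have hLr := half_lt_log_two_add hr
  rcases le_total b a with hba | hab
  · refine (log_rpow_mul_le_of_le hd hr hb hba h hs hs' hrs).trans ?_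
    gcongr
    exact le_add_of_nonneg_left (by positivity)
  · rw [mul_comm]
    refine (log_rpow_mul_le_of_le hd hr ha hab (by linarith) hs hs' hrs).trans ?_
    gcongr
    exact le_add_of_nonneg_right (by positivity)

theorem stmt_7 (d : ℕ) (hd : 1 ≤ d) :
    ∃ C : ℝ, 0 < C ∧ ∀ x : EuclideanSpace ℝ (Fin d),
      ∫ z : EuclideanSpace ℝ (Fin d),
          Real.log (2 + ‖x + z‖) ^ ((1 / 2) : ℝ) * (1 + ‖x + z‖) ^ (-(d : ℝ)) *
            (Real.log (2 + ‖z‖) ^ ((1 / 2) : ℝ) * (1 + ‖z‖) ^ (-(d : ℝ))) ≤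
        C * (1 + ‖x‖) ^ (-(d : ℝ)) * Real.log (2 + ‖x‖) ^ 2 := by
  have : Nonempty (Fin d) := ⟨⟨0, hd⟩⟩
  set v : ℝ := (volume : Measure (EuclideanSpace ℝ (Fin d))).real (Metric.ball 0 1) with hv
  have hv0 : 0 < v :=
    ENNReal.toReal_pos (Metric.measure_ball_pos _ _ one_pos).ne' measure_ball_lt_top.ne
  have hd0 : (1 : ℝ) ≤ d := by exact_mod_cast hd
  refine ⟨12 * 2 ^ (d : ℝ) * (8 * (d * v)), by positivity, fun x ↦ ?_⟩
  have hL := half_lt_log_two_add (norm_nonneg x)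
  set L := Real.log (2 + ‖x‖) with hLdef
  set s : ℝ := (4 * L)⁻¹ with hsdef
  have hs : 0 < s := by positivity
  have hs' : s ≤ 1 / 2 := by
    rw [hsdef]
    exact inv_le_of_inv_le₀ (by norm_num) (by linarith)
  have hrs : (1 + ‖x‖) ^ s ≤ 2 := by
    have hx := norm_nonneg x
    rw [← Real.log_le_log_iff (by positivity) (by norm_num), Real.log_rpow (by positivity)]
    have h1 : Real.log (1 + ‖x‖) ≤ L := Real.log_le_log (by positivity) (by linarith)
    have h2 : s * Real.log (1 + ‖x‖) ≤ s * L := by gcongr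
    have h3 : s * L = 1 / 4 := by rw [hsdef]; field_simp
    have h4 := Real.log_two_gt_d9
    linarith
  have hint : Integrable (fun z : EuclideanSpace ℝ (Fin d) ↦ (1 + ‖z‖) ^ (-((d : ℝ) + s))) :=
    integrable_one_add_norm (by simpa using hs)
  have hle := integral_one_add_norm_rpow_le_s7
    (volume : Measure (EuclideanSpace ℝ (Fin d))) hs
  rw [finrank_euclideanSpace_fin, ← hv] at hle
  calc _ ≤ ∫ z : EuclideanSpace ℝ (Fin d), 12 * 2 ^ (d : ℝ) * L * (1 + ‖x‖) ^ (-(d : ℝ)) *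
        ((1 + ‖x + z‖) ^ (-((d : ℝ) + s)) + (1 + ‖z‖) ^ (-((d : ℝ) + s))) := by
        refine integral_mono_of_nonneg (.of_forall fun z ↦ ?_)
          (((hint.comp_add_left x).add hint).const_mul _) (.of_forall fun z ↦ ?_)
        · have h1 := half_lt_log_two_add (norm_nonneg z)
          have h2 := half_lt_log_two_add (norm_nonneg (x + z))
          simp only [Pi.zero_apply]
          positivity
        · refine log_rpow_mul_le hd0 (norm_nonneg x) (norm_nonneg _) (norm_nonneg _) ?_
            hs.le hs' hrs
          simpa using norm_sub_le (x + z) z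
    _ = 12 * 2 ^ (d : ℝ) * L * (1 + ‖x‖) ^ (-(d : ℝ)) *
        (2 * ∫ z : EuclideanSpace ℝ (Fin d), (1 + ‖z‖) ^ (-((d : ℝ) + s))) := by
        rw [integral_const_mul, integral_add (hint.comp_add_left x) hint,
          integral_add_left_eq_self
            (fun z : EuclideanSpace ℝ (Fin d) ↦ (1 + ‖z‖) ^ (-((d : ℝ) + s))) x, two_mul]
    _ ≤ 12 * 2 ^ (d : ℝ) * L * (1 + ‖x‖) ^ (-(d : ℝ)) * (2 * (d * v / s)) := by
        gcongr
    _ = _ := by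
        rw [hsdef, div_inv_eq_mul]
        ring
end

section
/- Let d ≥ 1 and let f : ℝ^d → ℝ be measurable. Define F(x) := esssup_{y ∈ B(x)} |f(y)|, where B(x) is the open unit ball centered at x. Then for all exponents 1 ≤ p ≤ q < ∞ there exists a constant C depending only on d, p and q such that (∫_{ℝ^d} F(x)^q dx)^{1/q} ≤ C (∫_{ℝ^d} F(x)^p dx)^{1/p} (the inequality being trivial when the right-hand side is infinite). -/
open MeasureTheory

/-- On a ball of radius `1/2`, the function `g` is a.e. bounded by its `L^p`-averaged local
supremum function. -/
lemma ae_restrict_ball_le_of_lintegral_essSup {d : ℕ} {p : ℝ} (hp : 0 < p)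
    (g : EuclideanSpace ℝ (Fin d) → ENNReal) (c : EuclideanSpace ℝ (Fin d)) :
    ∀ᵐ y ∂(volume.restrict (Metric.ball c (1 / 2))),
      g y ≤ ((volume (Metric.ball (0 : EuclideanSpace ℝ (Fin d)) (1 / 2)))⁻¹ *
        ∫⁻ x, (essSup g (volume.restrict (Metric.ball x 1))) ^ p) ^ (1 / p) := by
  set S := essSup g (volume.restrict (Metric.ball c (1 / 2)))
  set m := volume (Metric.ball (0 : EuclideanSpace ℝ (Fin d)) (1 / 2))
  have hm0 : m ≠ 0 := (Metric.measure_ball_pos volume _ (by norm_num)).ne'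
  have hmt : m ≠ ⊤ := measure_ball_lt_top.ne
  have hmc : volume (Metric.ball c (1 / 2)) = m := Measure.addHaar_ball_center _ _ _
  have hS : S ^ p * m ≤ ∫⁻ x, (essSup g (volume.restrict (Metric.ball x 1))) ^ p := by
    rw [← hmc, ← setLIntegral_const]
    refine (setLIntegral_mono' measurableSet_ball fun z hz => ?_).trans
      (setLIntegral_le_lintegral _ _)
    refine ENNReal.rpow_le_rpow (essSup_mono_measure ?_) hp.le
    refine (Measure.restrict_mono (Metric.ball_subset_ball' ?_) le_rfl).absolutelyContinuous
    rw [Metric.mem_ball, dist_comm] at hz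
    linarith
  have hSM : S ≤ (m⁻¹ * ∫⁻ x, (essSup g (volume.restrict (Metric.ball x 1))) ^ p) ^ (1 / p) := by
    rw [one_div, ENNReal.le_rpow_inv_iff hp, mul_comm, ← div_eq_mul_inv,
      ENNReal.le_div_iff_mul_le (Or.inl hm0) (Or.inl hmt)]
    exact hS
  filter_upwards [ENNReal.ae_le_essSup g] with y hy using hy.trans hSM

/-- The local supremum function is bounded pointwise by its `L^p` norm. -/
lemma essSup_ball_le_of_lintegral_essSup {d : ℕ} {p : ℝ} (hp : 0 < p)
    (g : EuclideanSpace ℝ (Fin d) → ENNReal) (x : EuclideanSpace ℝ (Fin d)) :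
    essSup g (volume.restrict (Metric.ball x 1)) ≤
      ((volume (Metric.ball (0 : EuclideanSpace ℝ (Fin d)) (1 / 2)))⁻¹ *
        ∫⁻ x, (essSup g (volume.restrict (Metric.ball x 1))) ^ p) ^ (1 / p) := by
  refine essSup_le_of_ae_le _ (ae_restrict_of_ae (s := Metric.ball x 1) ?_)
  refine measure_null_of_locally_null _ fun c _ => ?_
  have h := ae_restrict_ball_le_of_lintegral_essSup hp g c
  rw [ae_restrict_iff' measurableSet_ball] at h
  refine ⟨_, inter_mem_nhdsWithin _ (Metric.ball_mem_nhds c (by norm_num : (0 : ℝ) < 1 / 2)), ?_⟩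
  refine measure_mono_null ?_ (ae_iff.1 h)
  exact fun y hy hyM => hy.1 (hyM hy.2)

theorem stmt_13 (d : ℕ) (hd : 1 ≤ d) (p q : ℝ) (hp : 1 ≤ p) (hpq : p ≤ q) :
    ∃ C : ℝ, 0 < C ∧ ∀ f : EuclideanSpace ℝ (Fin d) → ℝ, Measurable f →
      (∫⁻ x, (essSup (fun y => ENNReal.ofReal |f y|)
          (volume.restrict (Metric.ball x 1))) ^ q) ^ (1 / q) ≤
        ENNReal.ofReal C *
          (∫⁻ x, (essSup (fun y => ENNReal.ofReal |f y|)
            (volume.restrict (Metric.ball x 1))) ^ p) ^ (1 / p) := by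
  have hp0 : 0 < p := by linarith
  have hq0 : 0 < q := by linarith
  have hqp : 0 ≤ q - p := by linarith
  set m := volume (Metric.ball (0 : EuclideanSpace ℝ (Fin d)) (1 / 2))
  have hm0 : m ≠ 0 := (Metric.measure_ball_pos volume _ (by norm_num)).ne'
  have hmt : m ≠ ⊤ := measure_ball_lt_top.ne
  have hi0 : m⁻¹ ≠ 0 := ENNReal.inv_ne_zero.2 hmt
  have hit : m⁻¹ ≠ ⊤ := ENNReal.inv_ne_top.2 hm0
  set K := (m⁻¹) ^ (1 / p * (q - p) * (1 / q))
  have hKt : K ≠ ⊤ := ENNReal.rpow_ne_top_of_nonneg (by positivity) hit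
  have hK0 : 0 < K := ENNReal.rpow_pos (pos_iff_ne_zero.2 hi0) hit
  refine ⟨K.toReal, ENNReal.toReal_pos hK0.ne' hKt, fun f _ => ?_⟩
  rw [ENNReal.ofReal_toReal hKt]
  have hM := essSup_ball_le_of_lintegral_essSup hp0 fun y => ENNReal.ofReal |f y|
  set F := fun x => essSup (fun y => ENNReal.ofReal |f y|) (volume.restrict (Metric.ball x 1))
  change (∫⁻ x, F x ^ q) ^ (1 / q) ≤ K * (∫⁻ x, F x ^ p) ^ (1 / p)
  change ∀ x, F x ≤ (m⁻¹ * ∫⁻ x, F x ^ p) ^ (1 / p) at hM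
  set I := ∫⁻ x, F x ^ p
  rcases eq_or_ne I ⊤ with hI | hI
  · rw [hI, ENNReal.top_rpow_of_pos (by positivity), ENNReal.mul_top hK0.ne']
    exact le_top
  have hc : (m⁻¹ * I) ^ (1 / p * (q - p)) ≠ ⊤ :=
    ENNReal.rpow_ne_top_of_nonneg (by positivity) (ENNReal.mul_ne_top hit hI)
  have hint : ∫⁻ x, F x ^ q ≤ (m⁻¹ * I) ^ (1 / p * (q - p)) * I := by
    rw [← lintegral_const_mul' _ _ hc]
    refine lintegral_mono fun x => ?_
    calc F x ^ q = F x ^ (q - p) * F x ^ p := by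
          rw [← ENNReal.rpow_add_of_nonneg _ _ hqp hp0.le, sub_add_cancel]
      _ ≤ _ := by
          rw [ENNReal.rpow_mul]
          gcongr
          exact hM x
  calc (∫⁻ x, F x ^ q) ^ (1 / q)
      ≤ ((m⁻¹ * I) ^ (1 / p * (q - p)) * I) ^ (1 / q) := by gcongr
    _ = K * I ^ (1 / p) := by
      rw [ENNReal.mul_rpow_of_nonneg _ _ (by positivity), ← ENNReal.rpow_mul,
        ENNReal.mul_rpow_of_nonneg _ _ (by positivity), mul_assoc,
        ← ENNReal.rpow_add_of_nonneg _ _ (by positivity) (by positivity)]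
      congr 2
      field_simp
      ring
end

section
/- Let d ≥ 1 and β > d. Let m : ℝ^d → ℝ be measurable with |m(y)| ≤ (1+|y|)^{−β} for all y ∈ ℝ^d, and let g : ℝ^d → ℝ be continuously differentiable with compact support. Then there exists a constant C depending only on d and β such that for every ε ∈ (0, 1/2], |∫_{ℝ^d}∫_{ℝ^d} g(x+εy) g(x) m(y) dy dx − (∫_{ℝ^d} g(x)² dx)(∫_{ℝ^d} m(y) dy)| ≤ C (∫_{ℝ^d} g² + ∫_{ℝ^d} |∇g|²) · ε^{min(2, β−d)} · (1 + log(1/ε) if β = d+2, and with no logarithmic factor if β ≠ d+2). -/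
open MeasureTheory Set Module

section Increment

variable {E : Type*} [NormedAddCommGroup E] [MeasurableSpace E] [BorelSpace E] {μ : Measure E}
  {g : E → ℝ}

lemma integrable_mul_translate [IsFiniteMeasureOnCompacts μ] (hg : Continuous g)
    (hs : HasCompactSupport g) (h : E) : Integrable (fun x => g (x + h) * g x) μ :=
  Continuous.integrable_of_hasCompactSupport (by fun_prop) hs.mul_left

lemma integrable_sq_of_hasCompactSupport [IsFiniteMeasureOnCompacts μ] (hg : Continuous g)
    (hs : HasCompactSupport g) : Integrable (fun x => g x ^ 2) μ :=
  Continuous.integrable_of_hasCompactSupport (by fun_prop)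
    (hs.comp_left (g := fun t : ℝ => t ^ 2) (by simp))

lemma integrable_translate_add_mul_sq [μ.IsAddHaarMeasure] (hg : Continuous g)
    (hs : HasCompactSupport g) (h : E) (c : ℝ) :
    Integrable (fun x => (g (x + h) + c * g x) ^ 2) μ := by
  have h1 := integrable_sq_of_hasCompactSupport (μ := μ) hg hs
  have h3 := integrable_mul_translate (μ := μ) hg hs h
  exact (((h1.comp_add_right h).add (h1.const_mul (c ^ 2))).add (h3.const_mul (2 * c))).congr
    (.of_forall fun x => by simp only [Pi.add_apply]; ring)

lemma integral_translate_add_mul_sq [μ.IsAddHaarMeasure] (hg : Continuous g)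
    (hs : HasCompactSupport g) (h : E) (c : ℝ) :
    ∫ x, (g (x + h) + c * g x) ^ 2 ∂μ =
      (1 + c ^ 2) * (∫ x, g x ^ 2 ∂μ) + 2 * c * ∫ x, g (x + h) * g x ∂μ := by
  have h1 := integrable_sq_of_hasCompactSupport (μ := μ) hg hs
  have h2 : Integrable (fun x => g (x + h) ^ 2) μ := h1.comp_add_right h
  have h3 := integrable_mul_translate (μ := μ) hg hs h
  have hT : ∫ x, g (x + h) ^ 2 ∂μ = ∫ x, g x ^ 2 ∂μ :=
    integral_add_right_eq_self (fun x => g x ^ 2) h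
  have e : ∀ x, (g (x + h) + c * g x) ^ 2 =
      (g (x + h) ^ 2 + c ^ 2 * g x ^ 2) + 2 * c * (g (x + h) * g x) := fun x => by ring
  simp_rw [e]
  rw [integral_add (by exact h2.add (h1.const_mul _)) (h3.const_mul _),
    integral_add h2 (h1.const_mul _), integral_const_mul, integral_const_mul, hT]
  ring

end Increment

lemma sq_sub_translate_le {E : Type*} [NormedAddCommGroup E] [NormedSpace ℝ E] {g : E → ℝ}
    (hg : ContDiff ℝ 1 g) (x h : E) :
    (g (x + h) - g x) ^ 2 ≤ ‖h‖ ^ 2 * ∫ t in Ioc (0 : ℝ) 1, ‖fderiv ℝ g (x + t • h)‖ ^ 2 := by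
  have hc : Continuous (fderiv ℝ g) := hg.continuous_fderiv one_ne_zero
  have hc1 : Continuous fun t : ℝ => fderiv ℝ g (x + t • h) h := by fun_prop
  have hd : ∀ t : ℝ, HasDerivAt (fun t : ℝ => g (x + t • h)) (fderiv ℝ g (x + t • h) h) t := by
    intro t
    have h1 : HasDerivAt (fun t : ℝ => x + t • h) h t := by
      simpa using ((hasDerivAt_id t).smul_const h).const_add x
    exact ((hg.differentiable one_ne_zero _).hasFDerivAt).comp_hasDerivAt t h1
  have e : ∫ t in (0 : ℝ)..1, fderiv ℝ g (x + t • h) h = g (x + h) - g x := by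
    rw [intervalIntegral.integral_eq_sub_of_hasDerivAt (fun t _ => hd t)
      (hc1.intervalIntegrable _ _)]
    simp
  rw [intervalIntegral.integral_of_le zero_le_one] at e
  have : IsProbabilityMeasure (volume.restrict (Ioc (0 : ℝ) 1)) := ⟨by simp⟩
  have hi : ∀ {f : ℝ → ℝ}, Continuous f → IntegrableOn f (Ioc (0 : ℝ) 1) := fun hf =>
    hf.integrableOn_Ioc
  have hc2 : Continuous fun t : ℝ => ‖fderiv ℝ g (x + t • h)‖ ^ 2 := by fun_prop
  have J := (even_two.convexOn_pow (𝕜 := ℝ)).map_integral_le (μ := volume.restrict (Ioc (0 : ℝ) 1))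
    (by fun_prop) isClosed_univ (by simp) (hi hc1) (hi (hc1.pow 2))
  rw [← e, ← integral_const_mul]
  refine J.trans (integral_mono (hi (hc1.pow 2)) (hi (hc2.const_mul _)) fun t => ?_)
  have := (fderiv ℝ g (x + t • h)).le_opNorm h
  simp only [← mul_pow]
  rw [← sq_abs, mul_comm]
  exact pow_le_pow_left₀ (abs_nonneg _) this 2

section Translation

variable {E : Type*} [NormedAddCommGroup E] [NormedSpace ℝ E] [FiniteDimensional ℝ E]
  [MeasurableSpace E] [BorelSpace E] {μ : Measure E} [μ.IsAddHaarMeasure] {g : E → ℝ}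

lemma integral_sub_sq_le_fderiv (hg : ContDiff ℝ 1 g) (hs : HasCompactSupport g) (h : E) :
    ∫ x, (g (x + h) - g x) ^ 2 ∂μ ≤ ‖h‖ ^ 2 * ∫ x, ‖fderiv ℝ g x‖ ^ 2 ∂μ := by
  have hc : Continuous (fderiv ℝ g) := hg.continuous_fderiv one_ne_zero
  have hD : Integrable (fun x => ‖fderiv ℝ g x‖ ^ 2) μ :=
    Continuous.integrable_of_hasCompactSupport (by fun_prop)
      ((hs.fderiv ℝ).comp_left (g := fun t => ‖t‖ ^ 2) (by simp))
  have hT : ∀ t : ℝ, ∫ x, ‖fderiv ℝ g (x + t • h)‖ ^ 2 ∂μ = ∫ x, ‖fderiv ℝ g x‖ ^ 2 ∂μ :=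
    fun t => integral_add_right_eq_self (fun x => ‖fderiv ℝ g x‖ ^ 2) (t • h)
  have hF : Integrable (fun p : ℝ × E => ‖fderiv ℝ g (p.2 + p.1 • h)‖ ^ 2)
      ((volume.restrict (Ioc (0 : ℝ) 1)).prod μ) := by
    refine (integrable_prod_iff (Continuous.aestronglyMeasurable (by fun_prop))).2 ⟨?_, ?_⟩
    · exact .of_forall fun t => hD.comp_add_right (t • h)
    · simp only [norm_pow, norm_norm, hT]
      exact integrable_const _
  have hg0 := hg.continuous
  calc ∫ x, (g (x + h) - g x) ^ 2 ∂μ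
      ≤ ∫ x, ‖h‖ ^ 2 * (∫ t in Ioc (0 : ℝ) 1, ‖fderiv ℝ g (x + t • h)‖ ^ 2) ∂μ := by
        refine integral_mono ?_ (hF.integral_prod_right.const_mul _)
          fun x => sq_sub_translate_le hg x h
        simpa [sub_eq_add_neg] using integrable_translate_add_mul_sq (μ := μ) hg0 hs h (-1)
    _ = ‖h‖ ^ 2 * ∫ x, ‖fderiv ℝ g x‖ ^ 2 ∂μ := by
        rw [integral_const_mul, ← integral_integral_swap hF]
        simp [hT]

/-- The autocorrelation of a `C¹` compactly supported function is flat to second order. -/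
lemma abs_autocorrelation_sub_le (hg : ContDiff ℝ 1 g) (hs : HasCompactSupport g) (h : E) :
    |(∫ x, g (x + h) * g x ∂μ) - ∫ x, g x ^ 2 ∂μ| ≤
      2 * ((∫ x, g x ^ 2 ∂μ) + ∫ x, ‖fderiv ℝ g x‖ ^ 2 ∂μ) * min 1 (‖h‖ ^ 2) := by
  have hg0 := hg.continuous
  have e := integral_translate_add_mul_sq (μ := μ) hg0 hs h (-1)
  simp only [neg_one_mul, ← sub_eq_add_neg] at e
  have b := integral_sub_sq_le_fderiv (μ := μ) hg hs h
  have p : 0 ≤ ∫ x, (g (x + h) - g x) ^ 2 ∂μ := integral_nonneg fun x => sq_nonneg _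
  have hA : 0 ≤ ∫ x, g x ^ 2 ∂μ := integral_nonneg fun x => sq_nonneg _
  have hB : 0 ≤ ∫ x, ‖fderiv ℝ g x‖ ^ 2 ∂μ := integral_nonneg fun x => sq_nonneg _
  have q : 0 ≤ ∫ x, (g (x + h) + 1 * g x) ^ 2 ∂μ := integral_nonneg fun x => sq_nonneg _
  rw [integral_translate_add_mul_sq hg0 hs h] at q
  rw [abs_of_nonpos (by linarith)]
  rcases min_cases (1 : ℝ) (‖h‖ ^ 2) with ⟨hm, -⟩ | ⟨hm, -⟩ <;> rw [hm]
  · linarith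
  · have := mul_nonneg (sq_nonneg ‖h‖) hA
    have := mul_nonneg (sq_nonneg ‖h‖) hB
    nlinarith

lemma integrable_of_abs_le_one_add_norm_rpow {m : E → ℝ} {β : ℝ}
    (hβ : (finrank ℝ E : ℝ) < β) (hm : Measurable m) (hmb : ∀ y, |m y| ≤ (1 + ‖y‖) ^ (-β)) :
    Integrable m μ :=
  (integrable_one_add_norm hβ).mono' hm.aestronglyMeasurable (.of_forall hmb)

lemma abs_integral_correlation_sub_le {m : E → ℝ} {β : ℝ} (hβ : (finrank ℝ E : ℝ) < β)
    (hm : Measurable m) (hmb : ∀ y, |m y| ≤ (1 + ‖y‖) ^ (-β))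
    (hg : ContDiff ℝ 1 g) (hs : HasCompactSupport g) (ε : ℝ) :
    |(∫ x, ∫ y, g (x + ε • y) * g x * m y ∂μ ∂μ) - (∫ x, g x ^ 2 ∂μ) * ∫ y, m y ∂μ| ≤
      2 * ((∫ x, g x ^ 2 ∂μ) + ∫ x, ‖fderiv ℝ g x‖ ^ 2 ∂μ) *
        ∫ y, min 1 ((ε * ‖y‖) ^ 2) * (1 + ‖y‖) ^ (-β) ∂μ := by
  have hg0 := hg.continuous
  have hmi : Integrable m μ := integrable_of_abs_le_one_add_norm_rpow hβ hm hmb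
  obtain ⟨M, hM⟩ := hg0.bounded_above_of_compact_support hs
  have hF : Integrable (Function.uncurry fun x y => g (x + ε • y) * g x * m y) (μ.prod μ) := by
    have h1 : Integrable (fun p : E × E => g p.1 * m p.2) (μ.prod μ) :=
      (hg0.integrable_of_hasCompactSupport hs).mul_prod hmi
    refine (h1.bdd_mul (f := fun p : E × E => g (p.1 + ε • p.2)) (c := M)
      (Continuous.aestronglyMeasurable (by fun_prop)) (.of_forall fun p => hM _)).congr ?_
    exact .of_forall fun p => by simp [Function.uncurry, mul_assoc]
  have hφ := hF.integral_prod_right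
  simp only [Function.uncurry_apply_pair, integral_mul_const] at hφ
  rw [integral_integral_swap hF]
  simp only [integral_mul_const]
  rw [← integral_const_mul, ← integral_sub hφ (hmi.const_mul _), ← integral_const_mul,
    ← Real.norm_eq_abs]
  refine norm_integral_le_of_norm_le (Integrable.const_mul ?_ _) (.of_forall fun y => ?_)
  · refine (integrable_one_add_norm hβ).bdd_mul (c := 1)
      (Continuous.aestronglyMeasurable (by fun_prop)) (.of_forall fun y => ?_)
    rw [Real.norm_of_nonneg (by positivity)]
    exact min_le_left _ _
  · rw [← sub_mul, Real.norm_eq_abs, abs_mul, ← mul_assoc]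
    have := abs_autocorrelation_sub_le (μ := μ) hg hs (ε • y)
    rw [norm_smul, mul_pow, Real.norm_eq_abs, sq_abs, ← mul_pow] at this
    exact mul_le_mul this (hmb y) (abs_nonneg _) ((abs_nonneg _).trans this)

end Translation

section Radial

lemma integrableOn_rpow_mul_min {a : ℝ} (ha : a < -1) (ε : ℝ) :
    IntegrableOn (fun s : ℝ => s ^ a * min 1 ((ε * s) ^ 2)) (Ioi 1) := by
  refine (integrableOn_Ioi_rpow_of_lt ha one_pos).mul_bdd (c := 1)
    (Continuous.aestronglyMeasurable (by fun_prop)) (.of_forall fun y => ?_)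
  rw [Real.norm_of_nonneg (by positivity)]
  exact min_le_left _ _

lemma integral_rpow_mul_min_le {a : ℝ} (ha : a < -1) {ε : ℝ} (hε : 0 < ε) (hε1 : ε ≤ 1) :
    ∫ s in Ioi (1 : ℝ), s ^ a * min 1 ((ε * s) ^ 2) ≤
      ε ^ 2 * (∫ s in (1 : ℝ)..ε⁻¹, s ^ (a + 2)) + ε ^ (-(a + 1)) / (-(a + 1)) := by
  have hT : 1 ≤ ε⁻¹ := (one_le_inv₀ hε).2 hε1
  have hi := integrableOn_rpow_mul_min ha ε
  rw [← Ioc_union_Ioi_eq_Ioi hT] at hi ⊢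
  rw [setIntegral_union (Ioc_disjoint_Ioi le_rfl) measurableSet_Ioi hi.left_of_union
    hi.right_of_union]
  refine add_le_add ?_ ?_
  · rw [intervalIntegral.integral_of_le hT, ← integral_const_mul]
    have hc : ContinuousOn (fun s : ℝ => ε ^ 2 * s ^ (a + 2)) (Icc 1 ε⁻¹) := fun s hs =>
      ((Real.continuousAt_rpow_const _ _ (.inl (by linarith [hs.1]))).const_mul
        (ε ^ 2)).continuousWithinAt
    refine setIntegral_mono_on hi.left_of_union
      (hc.integrableOn_Icc.mono_set Ioc_subset_Icc_self) measurableSet_Ioc fun s hs => ?_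
    have hs0 : 0 < s := by linarith [hs.1]
    rw [Real.rpow_add hs0, Real.rpow_two]
    calc s ^ a * min 1 ((ε * s) ^ 2) ≤ s ^ a * (ε * s) ^ 2 := by
          gcongr; exact min_le_right _ _
      _ = _ := by ring
  · calc ∫ s in Ioi ε⁻¹, s ^ a * min 1 ((ε * s) ^ 2) ≤ ∫ s in Ioi ε⁻¹, s ^ a := by
          refine setIntegral_mono_on hi.right_of_union
            (integrableOn_Ioi_rpow_of_lt ha (by positivity)) measurableSet_Ioi fun s hs => ?_
          have hs0 : 0 < s := lt_trans (by positivity) (mem_Ioi.1 hs)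
          exact mul_le_of_le_one_right (by positivity) (min_le_left _ _)
      _ = _ := by
          rw [integral_Ioi_rpow_of_lt ha (by positivity), Real.inv_rpow hε.le, ← Real.rpow_neg hε.le]
          rw [div_neg, neg_div]

variable {E : Type*} [NormedAddCommGroup E] [NormedSpace ℝ E] [FiniteDimensional ℝ E]
  [Nontrivial E] [MeasurableSpace E] [BorelSpace E] {μ : Measure E} [μ.IsAddHaarMeasure]

lemma integral_min_mul_one_add_norm_rpow_le {β : ℝ} (hβ : (finrank ℝ E : ℝ) < β) {ε : ℝ}
    (hε : 0 < ε) :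
    ∫ y, min 1 ((ε * ‖y‖) ^ 2) * (1 + ‖y‖) ^ (-β) ∂μ ≤
      finrank ℝ E * μ.real (Metric.ball 0 1) *
        ∫ s in Ioi (1 : ℝ), s ^ ((finrank ℝ E : ℝ) - 1 - β) * min 1 ((ε * s) ^ 2) := by
  set n := finrank ℝ E with hn
  have hn1 : 1 ≤ n := finrank_pos
  have hI : Integrable (fun y : E => min 1 ((ε * ‖y‖) ^ 2) * (1 + ‖y‖) ^ (-β)) μ := by
    refine (integrable_one_add_norm hβ).bdd_mul (c := 1)
      (Continuous.aestronglyMeasurable (by fun_prop)) (.of_forall fun y => ?_)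
    rw [Real.norm_of_nonneg (by positivity)]
    exact min_le_left _ _
  have hR := (integrable_fun_norm_addHaar μ
    (f := fun r : ℝ => min 1 ((ε * r) ^ 2) * (1 + r) ^ (-β))).1 hI
  rw [integral_fun_norm_addHaar μ (fun r : ℝ => min 1 ((ε * r) ^ 2) * (1 + r) ^ (-β)),
    nsmul_eq_mul, smul_eq_mul, ← mul_assoc]
  refine mul_le_mul_of_nonneg_left ?_ (by positivity)
  have hmp := measurePreserving_add_left (volume : Measure ℝ) 1
  have hme := measurableEmbedding_addLeft (1 : ℝ)
  have hpre : (fun r : ℝ => 1 + r) ⁻¹' Ioi 1 = Ioi 0 := by ext; simp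
  have ha : (n : ℝ) - 1 - β < -1 := by linarith
  have hS := (hmp.integrableOn_comp_preimage hme).2 (integrableOn_rpow_mul_min ha ε)
  rw [← hmp.setIntegral_preimage_emb hme _ (Ioi 1)]
  rw [hpre] at hS ⊢
  refine setIntegral_mono_on hR hS measurableSet_Ioi fun r hr => ?_
  have hr0 : 0 < r := hr
  have h1 : (1 + r) ^ ((n : ℝ) - 1 - β) = (1 + r) ^ (n - 1) * (1 + r) ^ (-β) := by
    rw [← Real.rpow_natCast, ← Real.rpow_add (by linarith), Nat.cast_sub hn1]
    simp [sub_eq_add_neg]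
  rw [h1, smul_eq_mul, mul_comm (min _ _), ← mul_assoc]
  gcongr <;> linarith

end Radial

lemma integral_rpow_mul_min_le_rpow {γ ε : ℝ} (hγ : 0 < γ) (hγ2 : γ ≠ 2) (hε : 0 < ε)
    (hε1 : ε ≤ 1) :
    ∫ s in Ioi (1 : ℝ), s ^ (-1 - γ) * min 1 ((ε * s) ^ 2) ≤
      (1 / |γ - 2| + 1 / γ) * ε ^ min 2 γ := by
  have hT : 1 ≤ ε⁻¹ := (one_le_inv₀ hε).2 hε1
  have hp : ε ^ γ ≤ ε ^ min 2 γ := Real.rpow_le_rpow_of_exponent_ge hε hε1 (min_le_right _ _)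
  have hp2 : ε ^ (2 : ℝ) ≤ ε ^ min 2 γ :=
    Real.rpow_le_rpow_of_exponent_ge hε hε1 (min_le_left _ _)
  refine (integral_rpow_mul_min_le (by linarith) hε hε1).trans ?_
  rw [add_mul]
  refine add_le_add ?_ ?_
  · rw [integral_rpow (.inr ⟨fun h => hγ2 (by linarith), notMem_uIcc_of_lt one_pos (by linarith)⟩),
      Real.one_rpow, Real.inv_rpow hε.le, ← Real.rpow_neg hε.le, ← Real.rpow_two, ← mul_div_assoc,
      mul_sub, ← Real.rpow_add hε, mul_one, one_div_mul_eq_div]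
    rw [show (2 : ℝ) + -(-1 - γ + 2 + 1) = γ by ring, show -1 - γ + 2 + 1 = 2 - γ by ring]
    refine (le_abs_self _).trans ?_
    rw [abs_div, abs_sub_comm 2 γ]
    refine div_le_div_of_nonneg_right ?_ (abs_nonneg _)
    have := Real.rpow_pos_of_pos hε γ
    have := Real.rpow_pos_of_pos hε 2
    exact abs_sub_le_of_nonneg_of_le (by positivity) hp (by positivity) hp2
  · rw [show -(-1 - γ + 1) = γ by ring, one_div_mul_eq_div]
    gcongr

lemma integral_rpow_mul_min_le_log {ε : ℝ} (hε : 0 < ε) (hε1 : ε ≤ 1) :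
    ∫ s in Ioi (1 : ℝ), s ^ (-1 - 2 : ℝ) * min 1 ((ε * s) ^ 2) ≤
      ε ^ 2 * (1 + Real.log (1 / ε)) := by
  have hl : 0 ≤ Real.log (1 / ε) := Real.log_nonneg (by rw [one_div]; exact (one_le_inv₀ hε).2 hε1)
  refine (integral_rpow_mul_min_le (by norm_num) hε hε1).trans ?_
  have : ∫ s in (1 : ℝ)..ε⁻¹, s ^ (-1 - 2 + 2 : ℝ) = Real.log (1 / ε) := by
    norm_num [Real.rpow_neg_one, integral_inv_of_pos one_pos (inv_pos.2 hε)]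
  rw [this, show -(-1 - 2 + 1 : ℝ) = 2 by norm_num, Real.rpow_two]
  nlinarith [sq_nonneg ε]

theorem stmt_15 (d : ℕ) (hd : 1 ≤ d) (β : ℝ) (hβ : (d : ℝ) < β) :
    ∃ C : ℝ, 0 < C ∧
      ∀ m : EuclideanSpace ℝ (Fin d) → ℝ, Measurable m →
        (∀ y, |m y| ≤ (1 + ‖y‖) ^ (-β)) →
        ∀ g : EuclideanSpace ℝ (Fin d) → ℝ, ContDiff ℝ 1 g → HasCompactSupport g →
          ∀ ε : ℝ, ε ∈ Set.Ioc (0 : ℝ) (1 / 2) →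
            (β ≠ (d : ℝ) + 2 →
              |(∫ x, ∫ y, g (x + ε • y) * g x * m y) -
                  (∫ x, g x ^ 2) * ∫ y, m y| ≤
                C * ((∫ x, g x ^ 2) + ∫ x, ‖fderiv ℝ g x‖ ^ 2) *
                  ε ^ (min 2 (β - (d : ℝ)))) ∧
            (β = (d : ℝ) + 2 →
              |(∫ x, ∫ y, g (x + ε • y) * g x * m y) -
                  (∫ x, g x ^ 2) * ∫ y, m y| ≤
                C * ((∫ x, g x ^ 2) + ∫ x, ‖fderiv ℝ g x‖ ^ 2) *
                  ε ^ 2 * (1 + Real.log (1 / ε))) := by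
  have : Nonempty (Fin d) := ⟨⟨0, hd⟩⟩
  set V := (volume : Measure (EuclideanSpace ℝ (Fin d))).real (Metric.ball 0 1)
  have hV : 0 ≤ V := measureReal_nonneg
  have hγ : 0 < β - d := sub_pos.2 hβ
  set K := 1 / |β - d - 2| + 1 / (β - d) + 1
  have hK : 0 < K := by positivity
  have hfin : finrank ℝ (EuclideanSpace ℝ (Fin d)) = d := finrank_euclideanSpace_fin
  refine ⟨2 * (d * V * K) + 1, by positivity, fun m hm hmb g hg hs ε ⟨hε, hε2⟩ => ?_⟩
  have hε1 : ε ≤ 1 := by linarith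
  set N := (∫ x, g x ^ 2) + ∫ x, ‖fderiv ℝ g x‖ ^ 2
  have hN : 0 ≤ N :=
    add_nonneg (integral_nonneg fun x => sq_nonneg _) (integral_nonneg fun x => sq_nonneg _)
  have key : ∀ R : ℝ, 0 ≤ R →
      (∫ s in Ioi (1 : ℝ), s ^ (-1 - (β - d)) * min 1 ((ε * s) ^ 2)) ≤ K * R →
      |(∫ x, ∫ y, g (x + ε • y) * g x * m y) - (∫ x, g x ^ 2) * ∫ y, m y| ≤
        (2 * (d * V * K) + 1) * N * R := by
    intro R hR h
    refine (abs_integral_correlation_sub_le (by rwa [hfin]) hm hmb hg hs ε).trans ?_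
    have h2 := integral_min_mul_one_add_norm_rpow_le
      (μ := (volume : Measure (EuclideanSpace ℝ (Fin d)))) (β := β) (by rwa [hfin]) hε
    rw [hfin, show (d : ℝ) - 1 - β = -1 - (β - d) by ring] at h2
    calc _ ≤ 2 * N * (d * V * (K * R)) := by
          refine mul_le_mul_of_nonneg_left (h2.trans ?_) (by positivity)
          exact mul_le_mul_of_nonneg_left h (by positivity)
      _ ≤ 2 * N * (d * V * (K * R)) + N * R := le_add_of_nonneg_right (by positivity)
      _ = _ := by ring
  refine ⟨fun hne => key _ (by positivity) ?_, fun heq => ?_⟩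
  · refine (integral_rpow_mul_min_le_rpow hγ (fun h => hne (by linarith)) hε hε1).trans ?_
    refine mul_le_mul_of_nonneg_right ?_ (by positivity)
    simp [K]
  · have hl : 0 ≤ Real.log (1 / ε) :=
      Real.log_nonneg (by rw [one_div]; exact (one_le_inv₀ hε).2 hε1)
    rw [mul_assoc]
    refine key _ (by positivity) ?_
    have h2 : β - d = 2 := by linarith
    have hK1 : 1 ≤ K := le_add_of_nonneg_left (by positivity)
    rw [h2]
    exact (integral_rpow_mul_min_le_log hε hε1).trans
      (le_mul_of_one_le_left (by positivity) hK1)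
end
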